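/- arXiv:2511.09897 — 4 statements merged into one kernel-verified Lean document; each statement's English description precedes it below -/
import Mathlib

section
/- Consider the Bayesian linear model with Gaussian location prior: posterior π_loc ∝ exp(−V_loc) on ℝ^{1+d}, V_loc(ϑ, β) = g(ϑ) − (1/σ²)(Xᵀy)ᵀβ + (1/(2σ²))‖Xβ‖² + (τ²/2) ∑_{j=1}^d (β_j − ϑ)², where X ∈ ℝ^{n×d}, y ∈ ℝ^n, σ, τ > 0, and g : ℝ → ℝ is C². Let A := (1/σ²) XᵀX and assume A ⪰ a I for some a ≥ 0, and α ≤ g'' ≤ L with ℓ′_V := α + d a τ²/(a + τ²) > 0. Then the star-structured variational minimizer π⋆_loc (with ϑ as root variable) satisfies KL(π⋆_loc ‖ π_loc) ≤ ((dτ² + L)/(ℓ′_V (a + τ²)²)) · ∑_{i=1}^d ∑_{j>i} A_{ij}². -/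
open MeasureTheory ProbabilityTheory
open scoped ENNReal ProbabilityTheory

open Classical in
/-- Kullback–Leibler divergence: `∫ log (dμ/dπ) dμ` if `μ ≪ π` (and the integral is
well-defined), and `+∞` otherwise. -/
noncomputable def KL {E : Type*} [MeasurableSpace E] (μ π : Measure E) : ℝ≥0∞ :=
  if μ ≪ π ∧ Integrable (fun z => Real.log (μ.rnDeriv π z).toReal) μ then
    ENNReal.ofReal (∫ z, Real.log (μ.rnDeriv π z).toReal ∂μ)
  else ⊤

/-- The star-structured measure on `ℝ × ℝ^k` with root marginal `μ₁` and leaf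
conditional kernels `κ j`, i.e. `μ₁(dz₁) ∏_j κ_j(dz_j ∣ z₁)`. -/
noncomputable def starMeasure {k : ℕ} (μ₁ : Measure ℝ) (κ : Fin k → Kernel ℝ ℝ) :
    Measure (ℝ × (Fin k → ℝ)) :=
  μ₁.bind fun z₁ => (Measure.dirac z₁).prod (Measure.pi fun j => κ j z₁)

/-- `μ ∈ C_star`: the leaf coordinates are conditionally independent given the root. -/
def IsStar {k : ℕ} (μ : Measure (ℝ × (Fin k → ℝ))) : Prop :=
  IsProbabilityMeasure μ ∧
    ∃ (μ₁ : Measure ℝ) (κ : Fin k → Kernel ℝ ℝ),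
      IsProbabilityMeasure μ₁ ∧ (∀ j, IsMarkovKernel (κ j)) ∧ μ = starMeasure μ₁ κ

/-- The probability measure with density proportional to `exp (-V)` (w.r.t. Lebesgue). -/
noncomputable def gibbs {E : Type*} [MeasureSpace E] (V : E → ℝ) : Measure E :=
  ((volume.withDensity fun z => ENNReal.ofReal (Real.exp (-V z))) Set.univ)⁻¹ •
    (volume.withDensity fun z => ENNReal.ofReal (Real.exp (-V z)))


/-- Density of a finite product of real Gaussians. -/
lemma pi_gaussianReal_eq_withDensity {ι : Type*} [Fintype ι] (m : ι → ℝ) (v : ι → NNReal)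
    (hv : ∀ i, v i ≠ 0) :
    Measure.pi (fun i => gaussianReal (m i) (v i)) =
      (volume : Measure (ι → ℝ)).withDensity
        fun x => ENNReal.ofReal (∏ i, gaussianPDFReal (m i) (v i) (x i)) := by
  refine (Measure.pi_eq fun s hs => ?_)
  rw [withDensity_apply _ (MeasurableSet.univ_pi hs), volume_pi, Measure.restrict_pi_pi,
    ← ofReal_integral_eq_lintegral_ofReal, integral_fintype_prod_eq_prod,
    ENNReal.ofReal_prod_of_nonneg]
  · refine Finset.prod_congr rfl fun i _ => ?_
    rw [gaussianReal_apply_eq_integral _ (hv i)]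
  · exact fun i _ => integral_nonneg fun x => gaussianPDFReal_nonneg _ _ _
  · exact Integrable.fintype_prod fun i => (integrable_gaussianPDFReal _ _).restrict
  · exact Filter.Eventually.of_forall fun x =>
      Finset.prod_nonneg fun i _ => gaussianPDFReal_nonneg _ _ _

open Matrix MatrixOrder Matrix.Norms.L2Operator in
lemma lintegral_exp_neg_half_quadratic {ι : Type*} [Fintype ι] [DecidableEq ι]
    {P : Matrix ι ι ℝ} (hP : P.PosDef) :
    ∫⁻ x : ι → ℝ, ENNReal.ofReal (Real.exp (-(1 / 2 * (x ⬝ᵥ P *ᵥ x)))) =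
      ENNReal.ofReal (√(2 * Real.pi) ^ Fintype.card ι / √P.det) := by
  obtain ⟨B, hB, rfl⟩ := CStarAlgebra.isStrictlyPositive_iff_eq_star_mul_self.mp hP.isStrictlyPositive
  have hdet : B.det ≠ 0 := ((Matrix.isUnit_iff_isUnit_det B).mp hB).ne_zero
  have hpi : ∫⁻ y : ι → ℝ, ENNReal.ofReal (Real.exp (-(1 / 2 * (y ⬝ᵥ y)))) =
      ENNReal.ofReal (√(2 * Real.pi) ^ Fintype.card ι) := by
    have h1 : (Measure.pi fun _ : ι => gaussianReal 0 1) Set.univ = 1 := measure_univ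
    rw [pi_gaussianReal_eq_withDensity _ _ (fun _ => one_ne_zero),
      withDensity_apply _ MeasurableSet.univ, setLIntegral_univ] at h1
    have h2 : ∀ y : ι → ℝ, ENNReal.ofReal (Real.exp (-(1 / 2 * (y ⬝ᵥ y)))) =
        ENNReal.ofReal (√(2 * Real.pi) ^ Fintype.card ι) *
          ENNReal.ofReal (∏ i, gaussianPDFReal 0 1 (y i)) := by
      intro y
      rw [← ENNReal.ofReal_mul (by positivity)]
      congr 1
      simp only [gaussianPDFReal, Finset.prod_mul_distrib, Finset.prod_const, Finset.card_univ,
        ← Real.exp_sum, NNReal.coe_one, mul_one, sub_zero]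
      rw [← mul_assoc, ← mul_pow, mul_inv_cancel₀ (by positivity), one_pow, one_mul]
      congr 1
      simp only [dotProduct, Finset.mul_sum, ← Finset.sum_neg_distrib]
      exact Finset.sum_congr rfl fun i _ => by ring
    simp_rw [h2]
    rw [lintegral_const_mul' _ _ ENNReal.ofReal_ne_top, h1, mul_one]
  have hmap := Real.map_matrix_volume_pi_eq_smul_volume_pi hdet
  have hmeas : Measurable fun y : ι → ℝ => ENNReal.ofReal (Real.exp (-(1 / 2 * (y ⬝ᵥ y)))) := by
    unfold dotProduct; fun_prop
  have hlin : Measurable (Matrix.toLin' B) :=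
    (LinearMap.continuous_of_finiteDimensional _).measurable
  have hcomp : ∀ x : ι → ℝ, x ⬝ᵥ (star B * B) *ᵥ x = Matrix.toLin' B x ⬝ᵥ Matrix.toLin' B x := by
    intro x
    rw [← mulVec_mulVec, dotProduct_mulVec, star_eq_conjTranspose, conjTranspose_eq_transpose_of_trivial,
      vecMul_transpose, Matrix.toLin'_apply]
  simp_rw [hcomp]
  rw [← lintegral_map hmeas hlin, hmap, lintegral_smul_measure, hpi, smul_eq_mul,
    ← ENNReal.ofReal_mul (abs_nonneg _)]
  congr 1
  rw [det_mul, star_eq_conjTranspose, det_conjTranspose, star_trivial, Real.sqrt_mul_self_eq_abs, abs_inv]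
  ring

/-- `log det S ≤ tr S - n` for positive definite `S`. -/
lemma Matrix.PosDef.log_det_le_trace_sub_card {ι : Type*} [Fintype ι] [DecidableEq ι]
    {S : Matrix ι ι ℝ} (hS : S.PosDef) :
    Real.log S.det ≤ S.trace - Fintype.card ι := by
  rw [hS.isHermitian.det_eq_prod_eigenvalues, hS.isHermitian.trace_eq_sum_eigenvalues]
  simp only [RCLike.ofReal_real_eq_id, id]
  rw [Real.log_prod fun i _ => (hS.eigenvalues_pos i).ne']
  calc _ ≤ ∑ i, (hS.isHermitian.eigenvalues i - 1) :=
        Finset.sum_le_sum fun i _ => Real.log_le_sub_one_of_pos (hS.eigenvalues_pos i)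
    _ = _ := by simp [Finset.sum_sub_distrib]

open Matrix in
/-- If `P` is symmetric and `P ⪰ ρ I`, then `v ⬝ P⁻¹ v ≤ ‖v‖² / ρ`. -/
lemma dotProduct_inv_mulVec_le {ι : Type*} [Fintype ι] [DecidableEq ι]
    {P : Matrix ι ι ℝ} {ρ : ℝ} (hρ : 0 < ρ) (hdet : IsUnit P.det)
    (h : ∀ v : ι → ℝ, ρ * (v ⬝ᵥ v) ≤ v ⬝ᵥ P *ᵥ v) (v : ι → ℝ) :
    v ⬝ᵥ P⁻¹ *ᵥ v ≤ (v ⬝ᵥ v) / ρ := by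
  set w := P⁻¹ *ᵥ v with hw
  have hv : P *ᵥ w = v := by rw [hw, mulVec_mulVec, mul_nonsing_inv _ hdet, one_mulVec]
  have h1 := h w
  rw [hv, dotProduct_comm w v] at h1
  have h2 : 0 ≤ (v - ρ • w) ⬝ᵥ (v - ρ • w) := by
    simpa using dotProduct_self_star_nonneg (v - ρ • w)
  simp only [sub_dotProduct, dotProduct_sub, smul_dotProduct, dotProduct_smul, smul_eq_mul,
    dotProduct_comm w v] at h2
  rw [le_div_iff₀ hρ]
  nlinarith [mul_le_mul_of_nonneg_left h1 hρ.le]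

open Matrix MatrixOrder Matrix.Norms.L2Operator in
/-- Quantitative Hadamard inequality for a positive definite matrix `P ⪰ ρ I`. -/
lemma log_prod_diag_sub_log_det_le {ι : Type*} [Fintype ι] [DecidableEq ι]
    {P : Matrix ι ι ℝ} {ρ : ℝ} (hρ : 0 < ρ) (hP : P.PosDef)
    (h : ∀ v : ι → ℝ, ρ * (v ⬝ᵥ v) ≤ v ⬝ᵥ P *ᵥ v) :
    Real.log (∏ i, P i i) - Real.log P.det ≤
      (∑ i, ∑ j, if i = j then 0 else P i j ^ 2) / ρ ^ 2 := by
  set D : Matrix ι ι ℝ := diagonal fun i => P i i with hD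
  set R : Matrix ι ι ℝ := P - D with hR
  have hu : IsUnit P.det := isUnit_iff_ne_zero.mpr hP.det_pos.ne'
  have hdiag : ∀ i, ρ ≤ P i i := fun i => by simpa using h (Pi.single i 1)
  have hdpos : ∀ i, 0 < P i i := fun i => hρ.trans_le (hdiag i)
  have hDpos : D.PosDef := Matrix.PosDef.diagonal hdpos
  obtain ⟨C, hC, hCP⟩ :=
    CStarAlgebra.isStrictlyPositive_iff_eq_star_mul_self.mp hP.inv.isStrictlyPositive
  have hS : (C * D * Cᴴ).PosDef := by
    apply hDpos.mul_mul_conjTranspose_same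
    exact Matrix.vecMul_injective_of_isUnit hC
  have h1 := hS.log_det_le_trace_sub_card
  have htr : (C * D * Cᴴ).trace = (P⁻¹ * D).trace := by
    rw [trace_mul_comm, ← mul_assoc, hCP, star_eq_conjTranspose]
  have hdt : (C * D * Cᴴ).det = (∏ i, P i i) / P.det := by
    rw [det_mul_comm, ← mul_assoc, ← star_eq_conjTranspose, ← hCP, det_mul, hD, det_diagonal,
      det_nonsing_inv, Ring.inverse_eq_inv']
    ring
  rw [htr, hdt, Real.log_div (Finset.prod_pos fun i _ => hdpos i).ne' hP.det_pos.ne'] at h1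
  refine h1.trans ?_
  set Di : Matrix ι ι ℝ := diagonal fun i => (P i i)⁻¹ with hDi
  have hDDi : D * Di = 1 := by
    rw [hD, hDi, diagonal_mul_diagonal, ← diagonal_one]
    congr 1; funext i; exact mul_inv_cancel₀ (hdpos i).ne'
  have hRii : ∀ i, R i i = 0 := fun i => by simp [hR, hD]
  have hRsymm : ∀ i j, R i j = R j i := by
    intro i j
    have h2 : P i j = P j i := by simpa using hP.isHermitian.apply j i
    by_cases hij : i = j
    · rw [hij]
    · simp [hR, hD, hij, Ne.symm hij, h2]
  have hPP : P⁻¹ * P = 1 := nonsing_inv_mul _ hu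
  have hDPR : D = P - R := by rw [hR, sub_sub_cancel]
  have hPinv : P⁻¹ = Di - P⁻¹ * R * Di := by
    rw [hR, mul_sub, hPP, sub_mul, mul_assoc, hDDi, one_mul, mul_one, sub_sub_cancel]
  have htrace : (P⁻¹ * D).trace - Fintype.card ι = ((R * P⁻¹ * R) * Di).trace := by
    have h2 : (Di * R).trace = 0 := by
      simp [Matrix.trace, hDi, diagonal_mul, hRii]
    have h3 : P⁻¹ * R = Di * R - P⁻¹ * R * Di * R := by
      conv_lhs => rw [hPinv]
      rw [sub_mul]
    have h4 : (P⁻¹ * R * Di * R).trace = ((R * P⁻¹ * R) * Di).trace := by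
      rw [trace_mul_comm]; simp only [mul_assoc]
    rw [hDPR, mul_sub, hPP, trace_sub, h3, trace_sub, h2, trace_one, h4]
    ring
  rw [htrace]
  have hcol : ∀ k, (R * P⁻¹ * R) k k = (fun j => R k j) ⬝ᵥ P⁻¹ *ᵥ fun j => R k j := by
    intro k
    rw [dotProduct_mulVec]
    simp only [mul_apply, dotProduct, vecMul]
    exact Finset.sum_congr rfl fun j _ => by rw [hRsymm j k]
  have hRsq : ∀ i j, R i j * R i j = if i = j then 0 else P i j ^ 2 := by
    intro i j
    split_ifs with hij
    · rw [hij, hRii, mul_zero]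
    · simp [hR, hD, hij, sq]
  simp only [Matrix.trace, diag_apply, hDi, mul_diagonal]
  rw [Finset.sum_div]
  refine Finset.sum_le_sum fun k _ => ?_
  simp_rw [← hRsq]
  rw [hcol]
  have h5 := dotProduct_inv_mulVec_le hρ hu h fun j => R k j
  have h6 : (P k k)⁻¹ ≤ ρ⁻¹ := inv_anti₀ hρ (hdiag k)
  have h7 : 0 ≤ ((fun j => R k j) ⬝ᵥ fun j => R k j) / ρ :=
    div_nonneg (Finset.sum_nonneg fun j _ => mul_self_nonneg _) hρ.le
  calc _ ≤ (((fun j => R k j) ⬝ᵥ fun j => R k j) / ρ) * (P k k)⁻¹ :=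
        mul_le_mul_of_nonneg_right h5 (inv_nonneg.mpr (hdpos k).le)
    _ ≤ (((fun j => R k j) ⬝ᵥ fun j => R k j) / ρ) * ρ⁻¹ := mul_le_mul_of_nonneg_left h6 h7
    _ = _ := by simp only [dotProduct]; field_simp

lemma KL_withDensity_exp {E : Type*} [MeasurableSpace E] {μ π : Measure E} [SigmaFinite π]
    {φ : E → ℝ} (hφ : Measurable φ)
    (hμ : μ = π.withDensity fun z => ENNReal.ofReal (Real.exp (φ z))) (hintegrable : Integrable φ μ) :
    KL μ π = ENNReal.ofReal (∫ z, φ z ∂μ) := by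
  have hac : μ ≪ π := hμ ▸ withDensity_absolutelyContinuous _ _
  have hlog : (fun z => Real.log (μ.rnDeriv π z).toReal) =ᵐ[μ] φ := by
    refine hac.ae_le ?_
    have h := Measure.rnDeriv_withDensity π
      (f := fun z => ENNReal.ofReal (Real.exp (φ z))) (by fun_prop)
    rw [← hμ] at h
    filter_upwards [h] with z hz
    rw [hz, ENNReal.toReal_ofReal (Real.exp_pos _).le, Real.log_exp]
  rw [KL, if_pos ⟨hac, hintegrable.congr hlog.symm⟩, integral_congr_ae hlog]

lemma map_equiv_withDensity {E F : Type*} [MeasurableSpace E] [MeasurableSpace F]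
    (e : E ≃ᵐ F) (μ : Measure E) (f : E → ℝ≥0∞) :
    (μ.withDensity f).map e = (μ.map e).withDensity (f ∘ e.symm) := by
  ext s hs
  rw [Measure.map_apply e.measurable hs, withDensity_apply _ (e.measurable hs),
    withDensity_apply _ hs, e.restrict_map, lintegral_map_equiv]
  simp

/-- Translation of the second coordinate by a function of the first. -/
def shear {α E : Type*} [MeasurableSpace α] [MeasurableSpace E] [AddGroup E]
    [MeasurableAdd₂ E] [MeasurableSub₂ E] (m : α → E) (hm : Measurable m) : α × E ≃ᵐ α × E where
  toFun z := (z.1, z.2 + m z.1)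
  invFun z := (z.1, z.2 - m z.1)
  left_inv z := by simp
  right_inv z := by simp
  measurable_toFun := by
    change Measurable fun z : α × E => (z.1, z.2 + m z.1)
    fun_prop
  measurable_invFun := by
    change Measurable fun z : α × E => (z.1, z.2 - m z.1)
    fun_prop

lemma map_shear_volume {d : ℕ} (m : ℝ → Fin d → ℝ) (hm : Measurable m) :
    (volume : Measure (ℝ × (Fin d → ℝ))).map (shear m hm) = volume := by
  have h := MeasurePreserving.skew_product (g := fun x (y : Fin d → ℝ) => y + m x)
    (MeasurePreserving.id (volume : Measure ℝ)) (μc := (volume : Measure (Fin d → ℝ)))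
    (μd := (volume : Measure (Fin d → ℝ)))
    (by fun_prop) (Filter.Eventually.of_forall fun x => map_add_right_eq_self _ _)
  exact h.map_eq

/-- The Gaussian kernel on `ℝ` with mean `m z` and fixed variance. -/
noncomputable def gaussianKernel (m : ℝ → ℝ) (hm : Measurable m) (v : NNReal) : Kernel ℝ ℝ where
  toFun z := gaussianReal (m z) v
  measurable' := by
    have h : ∀ z, gaussianReal (m z) v = ((gaussianReal 0 v).map (Prod.mk z)).map
        fun p : ℝ × ℝ => p.2 + m p.1 := by
      intro z
      rw [Measure.map_map (by fun_prop) (by fun_prop)]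
      have := gaussianReal_map_add_const (μ := 0) (v := v) (m z)
      rw [zero_add] at this
      exact this.symm
    simp_rw [h]
    exact (Measure.measurable_map _ (by fun_prop)).comp Measurable.map_prodMk_left

instance (m : ℝ → ℝ) (hm : Measurable m) (v : NNReal) : IsMarkovKernel (gaussianKernel m hm v) :=
  ⟨fun z => inferInstanceAs (IsProbabilityMeasure (gaussianReal (m z) v))⟩

lemma starMeasure_gaussianKernel {d : ℕ} (μ₁ : Measure ℝ) [SFinite μ₁] (m : ℝ → Fin d → ℝ)
    (hm : Measurable m) (v : Fin d → NNReal) :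
    starMeasure μ₁ (fun j => gaussianKernel (fun z => m z j) (by fun_prop) (v j)) =
      (μ₁.prod (Measure.pi fun j => gaussianReal 0 (v j))).map (shear m hm) := by
  have h : ∀ z, (Measure.dirac z).prod (Measure.pi fun j =>
      gaussianKernel (fun z => m z j) (by fun_prop) (v j) z) =
      ((Measure.pi fun j => gaussianReal 0 (v j)).map (Prod.mk z)).map (shear m hm) := by
    intro z
    have h1 : (Measure.pi fun j => gaussianKernel (fun z => m z j) (by fun_prop) (v j) z) =
        (Measure.pi fun j => gaussianReal 0 (v j)).map fun x => x + m z := by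
      have h2 := Measure.pi_map_pi (μ := fun j => gaussianReal 0 (v j))
        (f := fun j x => x + m z j) (fun j => by fun_prop)
      simp_rw [gaussianReal_map_add_const, zero_add] at h2
      exact h2.symm
    rw [Measure.dirac_prod, h1, Measure.map_map (by fun_prop) (by fun_prop),
      Measure.map_map (shear m hm).measurable (by fun_prop)]
    rfl
  rw [starMeasure]
  simp_rw [h]
  ext s hs
  have hmeas : Measurable fun z =>
      ((Measure.pi fun j => gaussianReal 0 (v j)).map (Prod.mk z)).map (shear m hm) :=
    (Measure.measurable_map _ (shear m hm).measurable).comp Measurable.map_prodMk_left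
  rw [Measure.bind_apply hs hmeas.aemeasurable, Measure.map_apply (shear m hm).measurable hs,
    Measure.prod_apply ((shear m hm).measurable hs)]
  refine lintegral_congr fun z => ?_
  rw [Measure.map_apply (shear m hm).measurable hs,
    Measure.map_apply (by fun_prop) ((shear m hm).measurable hs)]

lemma integrable_integral_eval_mul_eval {d : ℕ} (v : Fin d → NNReal) {i j : Fin d} (hij : i ≠ j) :
    Integrable (fun x : Fin d → ℝ => x i * x j) (Measure.pi fun j => gaussianReal 0 (v j)) ∧
      ∫ x : Fin d → ℝ, x i * x j ∂(Measure.pi fun j => gaussianReal 0 (v j)) = 0 := by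
  have hind : iIndepFun (fun i (x : Fin d → ℝ) => x i) (Measure.pi fun j => gaussianReal 0 (v j)) :=
    iIndepFun_pi (X := fun _ => id) (fun _ => aemeasurable_id)
  have hintegrable : ∀ i, Integrable (fun x : Fin d → ℝ => x i)
      (Measure.pi fun j => gaussianReal 0 (v j)) := fun i =>
    integrable_comp_eval (f := fun x : ℝ => x) (i := i) (μ := fun j => gaussianReal 0 (v j))
      ((memLp_id_gaussianReal 1).integrable le_rfl)
  have hmean : ∫ x : Fin d → ℝ, x i ∂(Measure.pi fun j => gaussianReal 0 (v j)) = 0 := by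
    have h := integral_comp_eval (f := fun x : ℝ => x) (i := i) (μ := fun j => gaussianReal 0 (v j))
      (by fun_prop)
    rw [h, integral_id_gaussianReal]
  refine ⟨(hind.indepFun hij).integrable_mul (hintegrable i) (hintegrable j), ?_⟩
  have h := (hind.indepFun hij).integral_mul_eq_mul_integral (hintegrable i).1 (hintegrable j).1
  simp only [Pi.mul_apply] at h
  rw [h, hmean, zero_mul]

open Matrix in
/-- The product of centred Gaussians with precisions `P i i`, as a tilt of the Gaussian with
precision `P`. -/
lemma prod_gaussianPDFReal_eq {ι : Type*} [Fintype ι] [DecidableEq ι] {P : Matrix ι ι ℝ}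
    (hdiag : ∀ i, 0 < P i i) (hdet : 0 < P.det) (x : ι → ℝ) :
    ∏ i, gaussianPDFReal 0 (P i i)⁻¹.toNNReal (x i) =
      (√(2 * Real.pi) ^ Fintype.card ι / √P.det)⁻¹ * (Real.exp (-(1 / 2 * (x ⬝ᵥ P *ᵥ x))) *
        Real.exp (1 / 2 * (Real.log (∏ i, P i i) - Real.log P.det) +
          1 / 2 * ∑ i, ∑ j, if i = j then 0 else P i j * (x i * x j))) := by
  have hprod : 0 < ∏ i, P i i := Finset.prod_pos fun i _ => hdiag i
  have hlog : Real.exp (1 / 2 * (Real.log (∏ i, P i i) - Real.log P.det)) =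
      √(∏ i, P i i) / √P.det := by
    rw [← Real.log_div hprod.ne' hdet.ne', ← Real.sqrt_div hprod.le, Real.sqrt_eq_rpow,
      Real.rpow_def_of_pos (div_pos hprod hdet), mul_comm]
  have hsqrt : √(∏ i, P i i) = ∏ i, √(P i i) := Real.sqrt_prod _ fun i _ => (hdiag i).le
  have hquad : -(1 / 2 * (x ⬝ᵥ P *ᵥ x)) +
      1 / 2 * ∑ i, ∑ j, (if i = j then 0 else P i j * (x i * x j)) =
      ∑ i, -(x i ^ 2 * P i i / 2) := by
    simp only [dotProduct, mulVec, Finset.mul_sum, ← Finset.sum_neg_distrib,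
      ← Finset.sum_add_distrib]
    refine Finset.sum_congr rfl fun i _ => ?_
    rw [Finset.sum_eq_single i]
    · simp; ring
    · intro j _ hj
      rw [if_neg hj.symm]; ring
    · simp
  have hpdf : ∀ i, gaussianPDFReal 0 (P i i)⁻¹.toNNReal (x i) =
      (√(2 * Real.pi))⁻¹ * √(P i i) * Real.exp (-(x i ^ 2 * P i i / 2)) := by
    intro i
    rw [gaussianPDFReal, Real.coe_toNNReal _ (inv_nonneg.mpr (hdiag i).le),
      Real.sqrt_mul (by positivity), Real.sqrt_inv, mul_inv, inv_inv, sub_zero]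
    congr 2
    have := (hdiag i).ne'
    field_simp
  simp_rw [hpdf]
  rw [Finset.prod_mul_distrib, Finset.prod_mul_distrib, ← Real.exp_sum, ← hquad, ← hsqrt,
    Finset.prod_const, Finset.card_univ, Real.exp_add, Real.exp_add, hlog]
  have h1 : √P.det ≠ 0 := (Real.sqrt_pos.mpr hdet).ne'
  have h2 : √(2 * Real.pi) ^ Fintype.card ι ≠ 0 := by positivity
  rw [inv_pow]
  field_simp

open Matrix in
/-- If the leaves are conditionally Gaussian given the root with constant precision `P`, replacing
the conditional law by the product Gaussian with precisions `P i i` yields a star-structured measure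
with explicit divergence. -/
lemma exists_isStar_KL_gibbs_eq {d : ℕ} {P : Matrix (Fin d) (Fin d) ℝ} (hP : P.PosDef)
    {V : ℝ × (Fin d → ℝ) → ℝ} {h : ℝ → ℝ} (hh : Measurable h) {m : ℝ → Fin d → ℝ}
    (hm : Measurable m) (hV : ∀ z x, V (z, x + m z) = h z + 1 / 2 * (x ⬝ᵥ P *ᵥ x))
    [hprob : IsProbabilityMeasure (gibbs V)] :
    ∃ μ, IsStar μ ∧ KL μ (gibbs V) =
      ENNReal.ofReal (1 / 2 * (Real.log (∏ i, P i i) - Real.log P.det)) := by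
  have hdiag : ∀ i, 0 < P i i := fun i => hP.diag_pos
  set Z : ℝ := √(2 * Real.pi) ^ Fintype.card (Fin d) / √P.det with hZ
  have hZpos : 0 < Z := div_pos (by positivity) (Real.sqrt_pos.mpr hP.det_pos)
  set w : ℝ → ℝ≥0∞ := fun z => ENNReal.ofReal (Real.exp (-h z)) with hw
  set q : (Fin d → ℝ) → ℝ≥0∞ :=
    fun x => ENNReal.ofReal (Real.exp (-(1 / 2 * (x ⬝ᵥ P *ᵥ x)))) with hq
  have hwm : Measurable w := by fun_prop
  have hqm : Measurable q := by unfold q dotProduct mulVec dotProduct; fun_prop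
  set H : ℝ≥0∞ := ∫⁻ z, w z with hH
  set ρ : Measure (ℝ × (Fin d → ℝ)) := volume.withDensity fun z => w z.1 * q z.2 with hρ
  have hρm : Measurable fun z : ℝ × (Fin d → ℝ) => w z.1 * q z.2 := by fun_prop
  have hdens : (volume.withDensity fun z => ENNReal.ofReal (Real.exp (-V z))) =
      ρ.map (shear m hm) := by
    rw [map_equiv_withDensity, map_shear_volume]
    congr 1
    funext z
    have h1 : V z = h z.1 + 1 / 2 * ((z.2 - m z.1) ⬝ᵥ P *ᵥ (z.2 - m z.1)) := by
      rw [← hV, sub_add_cancel]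
    change _ = w z.1 * q (z.2 - m z.1)
    rw [h1, neg_add, Real.exp_add, ENNReal.ofReal_mul (Real.exp_pos _).le]
  have hmass : ρ Set.univ = H * ENNReal.ofReal Z := by
    rw [withDensity_apply _ MeasurableSet.univ, setLIntegral_univ, Measure.volume_eq_prod,
      lintegral_prod_mul hwm.aemeasurable hqm.aemeasurable, hq,
      lintegral_exp_neg_half_quadratic hP]
  have hgibbs : gibbs V = ((ρ Set.univ)⁻¹ • ρ).map (shear m hm) := by
    rw [gibbs, hdens, Measure.map_apply (shear m hm).measurable MeasurableSet.univ,
      Set.preimage_univ, Measure.map_smul]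
  have hone : (ρ Set.univ)⁻¹ * ρ Set.univ = 1 := by
    have h1 : gibbs V Set.univ = 1 := measure_univ
    rwa [hgibbs, Measure.map_apply (shear m hm).measurable MeasurableSet.univ,
      Set.preimage_univ, Measure.smul_apply, smul_eq_mul] at h1
  have hρ0 : ρ Set.univ ≠ 0 := fun h0 => by simp [h0] at hone
  have hρt : ρ Set.univ ≠ ⊤ := fun h0 => by simp [h0] at hone
  have hZ0 : ENNReal.ofReal Z ≠ 0 := by simpa using hZpos
  have hH0 : H ≠ 0 := fun h0 => hρ0 (by rw [hmass, h0, zero_mul])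
  have hHt : H ≠ ⊤ := fun h0 => hρt (by rw [hmass, h0, ENNReal.top_mul hZ0])
  set μ₁ : Measure ℝ := H⁻¹ • volume.withDensity w with hμ₁
  have : IsProbabilityMeasure μ₁ := ⟨by
    rw [hμ₁, Measure.smul_apply, withDensity_apply _ MeasurableSet.univ, setLIntegral_univ,
      smul_eq_mul, ENNReal.inv_mul_cancel hH0 hHt]⟩
  set v : Fin d → NNReal := fun i => (P i i)⁻¹.toNNReal with hv
  have hv0 : ∀ i, v i ≠ 0 := fun i => by simpa [hv] using hdiag i
  set ν := μ₁.prod (Measure.pi fun j => gaussianReal 0 (v j)) with hν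
  set φ : (Fin d → ℝ) → ℝ := fun x => 1 / 2 * (Real.log (∏ i, P i i) - Real.log P.det) +
          1 / 2 * ∑ i, ∑ j, if i = j then 0 else P i j * (x i * x j) with hφ
  have hφm : Measurable φ := by
    refine measurable_const.add (measurable_const.mul ?_)
    refine Finset.measurable_sum _ fun i _ => Finset.measurable_sum _ fun j _ => ?_
    split_ifs <;> fun_prop
  have hνρ : ν = ((ρ Set.univ)⁻¹ • ρ).withDensity
      fun z => ENNReal.ofReal (Real.exp (φ z.2)) := by
    rw [hν, hμ₁, pi_gaussianReal_eq_withDensity _ _ hv0, Measure.prod_smul_left,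
      prod_withDensity hwm (by unfold gaussianPDFReal; fun_prop), ← Measure.volume_eq_prod,
      withDensity_smul_measure, hρ,
      ← withDensity_mul _ hρm (by fun_prop), ← withDensity_smul _ (by fun_prop),
      ← withDensity_smul _ (by fun_prop)]
    congr 1
    funext z
    simp only [Pi.smul_apply, Pi.mul_apply, smul_eq_mul]
    rw [← hρ, hmass, prod_gaussianPDFReal_eq hdiag hP.det_pos, ← hZ,
      ENNReal.ofReal_mul (inv_nonneg.mpr hZpos.le), ENNReal.ofReal_mul (Real.exp_pos _).le,
      ENNReal.mul_inv (Or.inl hH0) (Or.inl hHt), ENNReal.ofReal_inv_of_pos hZpos]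
    ring
  have hφint : Integrable (fun z => φ z.2) ν ∧
      ∫ z, φ z.2 ∂ν = 1 / 2 * (Real.log (∏ i, P i i) - Real.log P.det) := by
    have hterm : ∀ i j, Integrable (fun x : Fin d → ℝ => if i = j then 0 else P i j * (x i * x j))
        (Measure.pi fun j => gaussianReal 0 (v j)) ∧
        ∫ x : Fin d → ℝ, (if i = j then 0 else P i j * (x i * x j))
          ∂(Measure.pi fun j => gaussianReal 0 (v j)) = 0 := by
      intro i j
      by_cases hij : i = j
      · simp [hij]
      · simp only [hij, if_false]
        obtain ⟨h1, h2⟩ := integrable_integral_eval_mul_eval v hij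
        exact ⟨h1.const_mul _, by rw [integral_const_mul, h2, mul_zero]⟩
    have hsum : Integrable (fun x : Fin d → ℝ => ∑ i, ∑ j,
        if i = j then 0 else P i j * (x i * x j)) (Measure.pi fun j => gaussianReal 0 (v j)) :=
      integrable_finsetSum _ fun i _ => integrable_finsetSum _ fun j _ => (hterm i j).1
    have hI : Integrable φ (Measure.pi fun j => gaussianReal 0 (v j)) :=
      (integrable_const _).add (hsum.const_mul _)
    refine ⟨hI.comp_snd μ₁, ?_⟩
    have hzero : ∫ x : Fin d → ℝ, (∑ i, ∑ j, if i = j then 0 else P i j * (x i * x j))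
        ∂(Measure.pi fun j => gaussianReal 0 (v j)) = 0 := by
      rw [integral_finsetSum _ fun i _ => integrable_finsetSum _ fun j _ => (hterm i j).1]
      refine Finset.sum_eq_zero fun i _ => ?_
      rw [integral_finsetSum _ fun j _ => (hterm i j).1]
      exact Finset.sum_eq_zero fun j _ => (hterm i j).2
    rw [hν, integral_fun_snd φ, probReal_univ, one_smul, hφ,
      integral_add (integrable_const _) (hsum.const_mul _), integral_const, probReal_univ,
      integral_const_mul, hzero]
    simp
  refine ⟨ν.map (shear m hm), ⟨Measure.isProbabilityMeasure_map
    (shear m hm).measurable.aemeasurable, μ₁, _, inferInstance, fun j => ?_,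
    (starMeasure_gaussianKernel μ₁ m hm v).symm⟩, ?_⟩
  · infer_instance
  · have hψ : Measurable ((fun z : ℝ × (Fin d → ℝ) => φ z.2) ∘ (shear m hm).symm) :=
      (by fun_prop : Measurable fun z : ℝ × (Fin d → ℝ) => φ z.2).comp (shear m hm).symm.measurable
    rw [KL_withDensity_exp hψ, integral_map_equiv]
    · simp only [Function.comp_apply, MeasurableEquiv.symm_apply_apply]
      rw [hφint.2]
    · rw [hνρ, map_equiv_withDensity, ← hgibbs]
      rfl
    · rw [integrable_map_equiv]
      convert hφint.1
      simp [Function.comp_def]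

open Matrix in
/-- The bilinear form of the conditional precision matrix `A + τ² I`. -/
lemma dotProduct_precision_mulVec {n d : ℕ} (X : Fin n → Fin d → ℝ) (c t : ℝ) (u w : Fin d → ℝ) :
    u ⬝ᵥ (of fun i j => c * (∑ l, X l i * X l j) + if i = j then t else 0) *ᵥ w =
      c * (∑ i, (∑ j, X i j * u j) * ∑ j, X i j * w j) + t * ∑ j, u j * w j := by
  have h : (of fun i j => c * (∑ l, X l i * X l j) + if i = j then t else 0) =
      c • ((of X)ᵀ * of X) + t • (1 : Matrix (Fin d) (Fin d) ℝ) := by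
    ext i j
    simp [mul_apply, one_apply]
  rw [h, add_mulVec, dotProduct_add, smul_mulVec, smul_mulVec, one_mulVec, dotProduct_smul,
    dotProduct_smul, ← mulVec_mulVec, dotProduct_mulVec, vecMul_transpose]
  rfl

lemma sum_off_diag_eq_two_mul {d : ℕ} {f : Fin d → Fin d → ℝ} (hf : ∀ i j, f i j = f j i) :
    (∑ i, ∑ j, if i = j then 0 else f i j) = 2 * ∑ i, ∑ j, if i < j then f i j else 0 := by
  have h1 : ∀ i j, (if i = j then 0 else f i j) =
      (if i < j then f i j else 0) + if j < i then f j i else 0 := by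
    intro i j
    rcases lt_trichotomy i j with h | h | h
    · simp [h, h.ne, h.not_gt]
    · simp [h]
    · simp [h, h.ne', h.not_gt, hf i j]
  simp_rw [h1, Finset.sum_add_distrib]
  rw [Finset.sum_comm (f := fun i j => if j < i then f j i else 0)]
  ring

/-- **Approximation quality of SSVI for the Bayesian linear model with Gaussian
location prior.** The state is `(ϑ, β) ∈ ℝ × ℝ^d` with root `ϑ`; the posterior is
`π_loc ∝ exp (-V_loc)` with
`V_loc(ϑ, β) = g(ϑ) - (1/σ²)(Xᵀy)ᵀβ + (1/(2σ²))‖Xβ‖² + (τ²/2) ∑ⱼ (βⱼ - ϑ)²`. -/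
theorem stmt10 {n d : ℕ} (hd : 1 ≤ d)
    (X : Fin n → Fin d → ℝ) (y : Fin n → ℝ) (σ τ : ℝ) (hσ : 0 < σ) (hτ : 0 < τ)
    (g : ℝ → ℝ) (hg : ContDiff ℝ 2 g)
    (a α L : ℝ) (ha : 0 ≤ a)
    -- A = (1/σ²) XᵀX ⪰ a I
    (hA : ∀ v : Fin d → ℝ,
      a * ∑ j, v j ^ 2 ≤ ∑ i, ∑ j, v i * ((σ ^ 2)⁻¹ * ∑ l, X l i * X l j) * v j)
    (hg'' : ∀ t, α ≤ deriv (deriv g) t ∧ deriv (deriv g) t ≤ L)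
    -- ℓ'_V = α + d a τ² / (a + τ²) > 0
    (hℓ' : 0 < α + d * a * τ ^ 2 / (a + τ ^ 2))
    (π : Measure (ℝ × (Fin d → ℝ))) [IsProbabilityMeasure π]
    (hπ : π = gibbs fun z : ℝ × (Fin d → ℝ) =>
      g z.1 - (σ ^ 2)⁻¹ * (∑ j, (∑ i, X i j * y i) * z.2 j)
        + (2 * σ ^ 2)⁻¹ * (∑ i, (∑ j, X i j * z.2 j) ^ 2)
        + τ ^ 2 / 2 * ∑ j, (z.2 j - z.1) ^ 2)
    -- π⋆ : the star-structured variational minimizer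
    (πstar : Measure (ℝ × (Fin d → ℝ))) (hstar : IsStar πstar)
    (hmin : ∀ μ, IsStar μ → KL πstar π ≤ KL μ π) :
    KL πstar π ≤ ENNReal.ofReal
      ((d * τ ^ 2 + L) / ((α + d * a * τ ^ 2 / (a + τ ^ 2)) * (a + τ ^ 2) ^ 2) *
        ∑ i : Fin d, ∑ j : Fin d, if i < j then
          ((σ ^ 2)⁻¹ * ∑ l, X l i * X l j) ^ 2 else 0) := by
  
  open Matrix in
  subst hπ
  set A : Fin d → Fin d → ℝ := fun i j => (σ ^ 2)⁻¹ * ∑ l, X l i * X l j with hAdef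
  set P : Matrix (Fin d) (Fin d) ℝ :=
    of fun i j => (σ ^ 2)⁻¹ * (∑ l, X l i * X l j) + if i = j then τ ^ 2 else 0 with hPdef
  have hρ : 0 < a + τ ^ 2 := by positivity
  have hform : ∀ u w : Fin d → ℝ, u ⬝ᵥ P *ᵥ w =
      (σ ^ 2)⁻¹ * (∑ i, (∑ j, X i j * u j) * ∑ j, X i j * w j) + τ ^ 2 * ∑ j, u j * w j :=
    dotProduct_precision_mulVec X _ _
  have hAsymm : ∀ i j, A i j = A j i := fun i j => by simp only [hAdef, mul_comm]
  have hlower : ∀ v : Fin d → ℝ, (a + τ ^ 2) * (v ⬝ᵥ v) ≤ v ⬝ᵥ P *ᵥ v := by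
    intro v
    have h1 : v ⬝ᵥ P *ᵥ v = (∑ i, ∑ j, v i * A i j * v j) + τ ^ 2 * (v ⬝ᵥ v) := by
      simp only [dotProduct, mulVec, hPdef, of_apply, Finset.mul_sum, ← Finset.sum_add_distrib]
      refine Finset.sum_congr rfl fun i _ => ?_
      simp only [add_mul, mul_add, Finset.sum_add_distrib, ite_mul, zero_mul, mul_ite, mul_zero,
        Finset.sum_ite_eq, Finset.mem_univ, if_true]
      congr 1
      · simp only [hAdef, Finset.mul_sum, Finset.sum_mul, mul_assoc]
      · ring
    have h2 : v ⬝ᵥ v = ∑ j, v j ^ 2 := by simp only [dotProduct, sq]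
    rw [h1, add_mul, h2]
    linarith [hA v]
  have hP : P.PosDef := by
    refine .of_dotProduct_mulVec_pos ?_ fun v hv => ?_
    · ext i j
      simp only [hPdef, conjTranspose_apply, of_apply, star_trivial, eq_comm (a := j) (b := i)]
      congr 1
      exact hAsymm j i
    · have h1 : 0 < v ⬝ᵥ v := by simpa using dotProduct_self_star_pos_iff.mpr hv
      rw [star_trivial]
      exact (mul_pos hρ h1).trans_le (hlower v)
  set m : ℝ → Fin d → ℝ := fun z =>
    P⁻¹ *ᵥ fun j => (σ ^ 2)⁻¹ * (∑ i, X i j * y i) + τ ^ 2 * z with hmdef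
  have hm : Measurable m := by unfold m mulVec dotProduct; fun_prop
  have hPm : ∀ z, P *ᵥ m z = fun j => (σ ^ 2)⁻¹ * (∑ i, X i j * y i) + τ ^ 2 * z := fun z => by
    rw [hmdef, mulVec_mulVec, mul_nonsing_inv _ (isUnit_iff_ne_zero.mpr hP.det_pos.ne'),
      one_mulVec]
  have hgm : Measurable g := hg.continuous.measurable
  set V : ℝ × (Fin d → ℝ) → ℝ := fun z =>
    g z.1 - (σ ^ 2)⁻¹ * (∑ j, (∑ i, X i j * y i) * z.2 j)
      + (2 * σ ^ 2)⁻¹ * (∑ i, (∑ j, X i j * z.2 j) ^ 2)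
      + τ ^ 2 / 2 * ∑ j, (z.2 j - z.1) ^ 2 with hVdef
  have hVm : Measurable fun z => V (z, m z) := by unfold V; fun_prop
  have hV : ∀ z x, V (z, x + m z) = V (z, m z) + 1 / 2 * (x ⬝ᵥ P *ᵥ x) := by
    intro z x
    have h1 := hform x (m z)
    rw [hPm] at h1
    have h2 : (x ⬝ᵥ fun j => (σ ^ 2)⁻¹ * (∑ i, X i j * y i) + τ ^ 2 * z) =
        (σ ^ 2)⁻¹ * (∑ j, (∑ i, X i j * y i) * x j) + τ ^ 2 * ∑ j, x j * z := by
      simp only [dotProduct, Finset.mul_sum (Finset.univ : Finset (Fin d)),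
        ← Finset.sum_add_distrib]
      exact Finset.sum_congr rfl fun j _ => by ring
    have h3 : (∑ j, (∑ i, X i j * y i) * (x + m z) j) =
        (∑ j, (∑ i, X i j * y i) * x j) + ∑ j, (∑ i, X i j * y i) * m z j := by
      simp only [Pi.add_apply, mul_add, Finset.sum_add_distrib]
    have h4 : (∑ i, (∑ j, X i j * (x + m z) j) ^ 2) =
        (∑ i, (∑ j, X i j * x j) * ∑ j, X i j * x j) +
          2 * (∑ i, (∑ j, X i j * x j) * ∑ j, X i j * m z j) +
          ∑ i, (∑ j, X i j * m z j) ^ 2 := by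
      rw [Finset.mul_sum, ← Finset.sum_add_distrib, ← Finset.sum_add_distrib]
      refine Finset.sum_congr rfl fun i _ => ?_
      simp only [Pi.add_apply, mul_add, Finset.sum_add_distrib]
      ring
    have h5 : (∑ j, ((x + m z) j - z) ^ 2) = (∑ j, x j * x j) + 2 * (∑ j, x j * m z j)
        - 2 * (∑ j, x j * z) + ∑ j, (m z j - z) ^ 2 := by
      simp only [Finset.mul_sum, ← Finset.sum_add_distrib, ← Finset.sum_sub_distrib]
      exact Finset.sum_congr rfl fun j _ => by rw [Pi.add_apply]; ring
    simp only [hVdef]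
    rw [h3, h4, h5, hform x x, mul_inv]
    rw [h2] at h1
    linear_combination -h1
  obtain ⟨μ, hμ, hKL⟩ := exists_isStar_KL_gibbs_eq hP hVm hm hV
  refine (hmin μ hμ).trans ?_
  rw [hKL]
  refine ENNReal.ofReal_le_ofReal ?_
  have hdet := log_prod_diag_sub_log_det_le hρ hP hlower
  have hoff : (∑ i, ∑ j, if i = j then 0 else P i j ^ 2) =
      2 * ∑ i, ∑ j, if i < j then A i j ^ 2 else 0 := by
    rw [← sum_off_diag_eq_two_mul fun i j => by rw [hAsymm]]
    refine Finset.sum_congr rfl fun i _ => Finset.sum_congr rfl fun j _ => ?_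
    by_cases hij : i = j
    · simp [hij]
    · simp [hij, hPdef, hAdef]
  rw [hoff] at hdet
  have hS : 0 ≤ ∑ i, ∑ j, if i < j then A i j ^ 2 else 0 :=
    Finset.sum_nonneg fun i _ => Finset.sum_nonneg fun j _ => by split_ifs <;> positivity
  have hfactor : 1 / (a + τ ^ 2) ^ 2 ≤
      (d * τ ^ 2 + L) / ((α + d * a * τ ^ 2 / (a + τ ^ 2)) * (a + τ ^ 2) ^ 2) := by
    have h1 : d * a * τ ^ 2 / (a + τ ^ 2) ≤ d * τ ^ 2 := by
      rw [div_le_iff₀ hρ]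
      nlinarith [show (0 : ℝ) ≤ d * τ ^ 2 * τ ^ 2 by positivity]
    have h2 := (hg'' 0).1.trans (hg'' 0).2
    rw [div_le_div_iff₀ (by positivity) (by positivity), one_mul]
    exact mul_le_mul_of_nonneg_right (by linarith) (by positivity)
  calc _ ≤ 1 / 2 * ((2 * ∑ i, ∑ j, if i < j then A i j ^ 2 else 0) / (a + τ ^ 2) ^ 2) := by
        linarith
    _ = 1 / (a + τ ^ 2) ^ 2 * ∑ i, ∑ j, if i < j then A i j ^ 2 else 0 := by ring
    _ ≤ _ := mul_le_mul_of_nonneg_right hfactor hS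
end

section
/- Let τ₀, τ₁ > 0 with τ₁² < τ₀², let ν₀ and ν₁ be the densities of N(0, τ₀^{−2}) and N(0, τ₁^{−2}) respectively, and let η ∈ [0, 1). Define ξ(x) := −log( η ν₀(x) + (1 − η) ν₁(x) ). Then for every x ∈ ℝ, ξ''(x) ≥ τ₁² − 2(τ₀² − τ₁²) log( 1 + η τ₀ / ((1 − η) e τ₁) ). -/
/-- The density of the univariate Gaussian `N(0, τ⁻²)`. -/
noncomputable def gaussDens (τ : ℝ) (x : ℝ) : ℝ :=
  τ / Real.sqrt (2 * Real.pi) * Real.exp (-(τ ^ 2 * x ^ 2) / 2)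

/-- The negative log-density of the two-component Gaussian scale mixture
`η N(0, τ₀⁻²) + (1 - η) N(0, τ₁⁻²)`. -/
noncomputable def mixPotential (τ₀ τ₁ η : ℝ) (x : ℝ) : ℝ :=
  -Real.log (η * gaussDens τ₀ x + (1 - η) * gaussDens τ₁ x)

lemma gaussDens_pos {τ : ℝ} (hτ : 0 < τ) (x : ℝ) : 0 < gaussDens τ x := by
  unfold gaussDens
  positivity

lemma hasDerivAt_gaussDens (τ x : ℝ) :
    HasDerivAt (gaussDens τ) (-(τ ^ 2 * x) * gaussDens τ x) x := by
  have h : HasDerivAt (fun y : ℝ => -(τ ^ 2 * y ^ 2) / 2) (-(τ ^ 2 * x)) x := by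
    refine ((((hasDerivAt_pow 2 x).const_mul (τ ^ 2)).neg).div_const 2).congr_deriv ?_
    norm_num
    ring
  refine (h.exp.const_mul (τ / Real.sqrt (2 * Real.pi))).congr_deriv ?_
  unfold gaussDens
  ring

/-- The log-density ratio of two centred Gaussians is quadratic. -/
lemma gaussDens_mul_exp (τ₀ τ₁ x : ℝ) :
    τ₁ * (gaussDens τ₀ x * Real.exp ((τ₀ ^ 2 - τ₁ ^ 2) * x ^ 2 / 2)) =
      τ₀ * gaussDens τ₁ x := by
  unfold gaussDens
  rw [mul_assoc (τ₀ / _), ← Real.exp_add,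
    show -(τ₀ ^ 2 * x ^ 2) / 2 + (τ₀ ^ 2 - τ₁ ^ 2) * x ^ 2 / 2 = -(τ₁ ^ 2 * x ^ 2) / 2 by ring]
  ring

lemma mixture_pos {τ₀ τ₁ η : ℝ} (hτ₀ : 0 < τ₀) (hτ₁ : 0 < τ₁) (hη : η ∈ Set.Ico (0 : ℝ) 1)
    (x : ℝ) : 0 < η * gaussDens τ₀ x + (1 - η) * gaussDens τ₁ x :=
  add_pos_of_nonneg_of_pos (mul_nonneg hη.1 (gaussDens_pos hτ₀ x).le)
    (mul_pos (sub_pos.2 hη.2) (gaussDens_pos hτ₁ x))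

lemma deriv_mixPotential {τ₀ τ₁ η : ℝ} (hτ₀ : 0 < τ₀) (hτ₁ : 0 < τ₁)
    (hη : η ∈ Set.Ico (0 : ℝ) 1) :
    deriv (mixPotential τ₀ τ₁ η) = fun x =>
      x * (τ₀ ^ 2 * (η * gaussDens τ₀ x) + τ₁ ^ 2 * ((1 - η) * gaussDens τ₁ x)) /
        (η * gaussDens τ₀ x + (1 - η) * gaussDens τ₁ x) := by
  funext x
  have h := ((((hasDerivAt_gaussDens τ₀ x).const_mul η).add
    ((hasDerivAt_gaussDens τ₁ x).const_mul (1 - η))).log (mixture_pos hτ₀ hτ₁ hη x).ne').neg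
  refine HasDerivAt.deriv (h.congr_deriv ?_)
  simp only [Pi.add_apply]
  rw [← neg_div]
  congr 1
  ring

/-- The second derivative in terms of the posterior weight `p` of the first component. -/
lemma deriv_deriv_mixPotential {τ₀ τ₁ η : ℝ} (hτ₀ : 0 < τ₀) (hτ₁ : 0 < τ₁)
    (hη : η ∈ Set.Ico (0 : ℝ) 1) (x p : ℝ)
    (hp : p = η * gaussDens τ₀ x / (η * gaussDens τ₀ x + (1 - η) * gaussDens τ₁ x)) :
    deriv (deriv (mixPotential τ₀ τ₁ η)) x =
      τ₁ ^ 2 + p * (τ₀ ^ 2 - τ₁ ^ 2) - p * (1 - p) * (τ₀ ^ 2 - τ₁ ^ 2) ^ 2 * x ^ 2 := by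
  rw [deriv_mixPotential hτ₀ hτ₁ hη]
  have hM := (mixture_pos hτ₀ hτ₁ hη x).ne'
  have hA := (hasDerivAt_gaussDens τ₀ x).const_mul η
  have hB := (hasDerivAt_gaussDens τ₁ x).const_mul (1 - η)
  have h := ((hasDerivAt_id x).mul ((hA.const_mul (τ₀ ^ 2)).add (hB.const_mul (τ₁ ^ 2)))).div
    (hA.add hB) hM
  refine HasDerivAt.deriv (h.congr_deriv ?_)
  simp only [Pi.add_apply, Pi.mul_apply, id]
  rw [hp]
  field_simp
  ring

/-- The tangent-line bound at `t = 0` for the convex function `t ↦ log (1 + u * exp t)`. -/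
lemma log_one_add_add_mul_le_log_one_add_mul_exp {u : ℝ} (hu : 0 ≤ u) (t : ℝ) :
    Real.log (1 + u) + u / (1 + u) * t ≤ Real.log (1 + u * Real.exp t) := by
  have h1 : 0 < 1 + u := by linarith
  have h := convexOn_exp.2 (Set.mem_univ 0) (Set.mem_univ t)
    (show 0 ≤ 1 / (1 + u) by positivity) (show 0 ≤ u / (1 + u) by positivity)
    (by field_simp)
  simp only [smul_eq_mul, mul_zero, zero_add, Real.exp_zero, mul_one] at h
  rw [Real.le_log_iff_exp_le (by positivity), Real.exp_add, Real.exp_log h1]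
  calc (1 + u) * Real.exp (u / (1 + u) * t)
      ≤ (1 + u) * (1 / (1 + u) + u / (1 + u) * Real.exp t) := by gcongr
    _ = 1 + u * Real.exp t := by field_simp

lemma weight_mul_sub_le_log {u s : ℝ} (hu : 0 ≤ u) (hs : 0 ≤ s) :
    u / (1 + u) * (1 - u / (1 + u)) * s - u / (1 + u) / 2 ≤
      Real.log (1 + u * Real.exp (s - 1)) := by
  have h1 : 0 < 1 + u := by linarith
  have htan := log_one_add_add_mul_le_log_one_add_mul_exp hu (s - 1)
  have hlog := Real.one_sub_inv_le_log_of_pos h1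
  have hp : 1 - (1 + u)⁻¹ = u / (1 + u) := by
    field_simp
    ring
  rw [hp] at hlog
  have hp0 : 0 ≤ u / (1 + u) := by positivity
  nlinarith [mul_nonneg (sq_nonneg (u / (1 + u))) hs]

/-- **Semi-log-concavity of a scale mixture of two Gaussians**: for `τ₁² < τ₀²` and
`η ∈ [0, 1)`, the potential `ξ = -log(η ν₀ + (1-η) ν₁)` satisfies
`ξ''(x) ≥ τ₁² - 2 (τ₀² - τ₁²) log (1 + η τ₀ / ((1-η) e τ₁))` for all `x`. -/
theorem stmt11 (τ₀ τ₁ : ℝ) (hτ₀ : 0 < τ₀) (hτ₁ : 0 < τ₁) (hlt : τ₁ ^ 2 < τ₀ ^ 2)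
    (η : ℝ) (hη : η ∈ Set.Ico (0 : ℝ) 1) (x : ℝ) :
    τ₁ ^ 2 - 2 * (τ₀ ^ 2 - τ₁ ^ 2) *
        Real.log (1 + η * τ₀ / ((1 - η) * Real.exp 1 * τ₁)) ≤
      deriv (deriv (mixPotential τ₀ τ₁ η)) x := by
  have hη' : 0 < 1 - η := sub_pos.2 hη.2
  have hD : 0 < τ₀ ^ 2 - τ₁ ^ 2 := sub_pos.2 hlt
  have hA : 0 ≤ η * gaussDens τ₀ x := mul_nonneg hη.1 (gaussDens_pos hτ₀ x).le
  have hg₁ := gaussDens_pos hτ₁ x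
  have hM := mixture_pos hτ₀ hτ₁ hη x
  set s := (τ₀ ^ 2 - τ₁ ^ 2) * x ^ 2 / 2 with hs
  set u := η * gaussDens τ₀ x / ((1 - η) * gaussDens τ₁ x) with hu
  have hu0 : 0 ≤ u := by positivity
  have hp : u / (1 + u) =
      η * gaussDens τ₀ x / (η * gaussDens τ₀ x + (1 - η) * gaussDens τ₁ x) := by
    have h1u : 1 + u ≠ 0 := by positivity
    rw [div_eq_div_iff h1u hM.ne', hu]
    field_simp
    ring
  have hexp : u * Real.exp (s - 1) = η * τ₀ / ((1 - η) * Real.exp 1 * τ₁) := by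
    have hq := gaussDens_mul_exp τ₀ τ₁ x
    rw [← hs] at hq
    rw [Real.exp_sub, hu, div_mul_div_comm, div_eq_div_iff (by positivity) (by positivity)]
    linear_combination η * (1 - η) * Real.exp 1 * hq
  rw [deriv_deriv_mixPotential hτ₀ hτ₁ hη x _ hp, ← hexp]
  have key := mul_le_mul_of_nonneg_left
    (weight_mul_sub_le_log hu0 (show 0 ≤ s by positivity)) hD.le
  have hsx : (τ₀ ^ 2 - τ₁ ^ 2) * x ^ 2 = 2 * s := by
    rw [hs]
    ring
  have hquad : u / (1 + u) * (1 - u / (1 + u)) * (τ₀ ^ 2 - τ₁ ^ 2) ^ 2 * x ^ 2 =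
      2 * ((τ₀ ^ 2 - τ₁ ^ 2) * (u / (1 + u) * (1 - u / (1 + u)) * s)) := by
    linear_combination u / (1 + u) * (1 - u / (1 + u)) * (τ₀ ^ 2 - τ₁ ^ 2) * hsx
  linarith
end

section
/- Let π ∝ exp(−V) on ℝ^d (d ≥ 2) with V C² satisfying the growth condition and assumptions (R), (P1), (P2), and (RD+). Let π⋆(dz) = p⋆(dz₁) ∏_{j=2}^d q⋆_j(dz_j ∣ z₁) be the star-structured minimizer of KL(· ‖ π) over C_star, whose conditional densities q⋆_i(z_i ∣ z₁) are assumed twice continuously differentiable in (z₁, z_i). Define L := max_{i ≥ 2} sup_{z₁, z_i ∈ ℝ} |∂_{z₁}∂_{z_i} log q⋆_i(z_i ∣ z₁)|. Then L ≤ L̄ := ℓ_V · max_{i ≥ 2}‖∂_{1i}V‖_{L∞} / ( ℓ_V − max_{i ≥ 2}‖∑_{j ≥ 2, j ≠ i} |∂_{ij}V|‖_{L∞} ) < +∞. -/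
open MeasureTheory ProbabilityTheory
open scoped ENNReal ProbabilityTheory

/-- The squared Euclidean norm on `ℝ × ℝ^k`. -/
def sqNorm {k : ℕ} (v : ℝ × (Fin k → ℝ)) : ℝ := v.1 ^ 2 + ∑ i, v.2 i ^ 2

/-- Growth condition: for every `c₂ > 0` there is `c₁ > 0` with
`|V z| ≤ c₁ exp (c₂ ‖z‖²)`. -/
def GrowthCond {k : ℕ} (V : ℝ × (Fin k → ℝ) → ℝ) : Prop :=
  ∀ c₂ : ℝ, 0 < c₂ → ∃ c₁ : ℝ, 0 < c₁ ∧ ∀ z, |V z| ≤ c₁ * Real.exp (c₂ * sqNorm z)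

/-- Second derivative (Hessian bilinear form) of `V` at `z` in directions `u, v`. -/
noncomputable def hess {k : ℕ} (V : ℝ × (Fin k → ℝ) → ℝ)
    (z u v : ℝ × (Fin k → ℝ)) : ℝ :=
  fderiv ℝ (fun w => fderiv ℝ V w u) z v

/-- The root coordinate direction `e₁`. -/
def e0 {k : ℕ} : ℝ × (Fin k → ℝ) := (1, 0)

/-- The `i`-th leaf coordinate direction. -/
def eL {k : ℕ} (i : Fin k) : ℝ × (Fin k → ℝ) := (0, Pi.single i 1)

/-- Likelihood-ratio order implies stochastic order. -/
lemma measure_Iic_le_of_likelihoodRatio {f g : ℝ → ℝ} (hf : Measurable f) (hg : Measurable g)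
    (hf0 : ∀ x, 0 ≤ f x) (hg0 : ∀ x, 0 ≤ g x)
    [IsProbabilityMeasure (volume.withDensity fun x => ENNReal.ofReal (f x))]
    [IsProbabilityMeasure (volume.withDensity fun x => ENNReal.ofReal (g x))]
    (h : ∀ s t, s ≤ t → g t * f s ≤ g s * f t) (x : ℝ) :
    (volume.withDensity fun x => ENNReal.ofReal (f x)) (Set.Iic x) ≤
      (volume.withDensity fun x => ENNReal.ofReal (g x)) (Set.Iic x) := by
  have hf' : Measurable fun x => ENNReal.ofReal (f x) := hf.ennreal_ofReal
  have hg' : Measurable fun x => ENNReal.ofReal (g x) := hg.ennreal_ofReal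
  have key : (volume.withDensity fun x => ENNReal.ofReal (g x)) (Set.Ioi x) *
      (volume.withDensity fun x => ENNReal.ofReal (f x)) (Set.Iic x) ≤
      (volume.withDensity fun x => ENNReal.ofReal (f x)) (Set.Ioi x) *
      (volume.withDensity fun x => ENNReal.ofReal (g x)) (Set.Iic x) := by
    simp only [withDensity_apply _ measurableSet_Ioi, withDensity_apply _ measurableSet_Iic]
    rw [← lintegral_mul_const _ hg', ← lintegral_mul_const _ hf']
    refine setLIntegral_mono (hf'.mul_const _) fun t ht => ?_
    rw [← lintegral_const_mul _ hf', ← lintegral_const_mul _ hg']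
    refine setLIntegral_mono (hg'.const_mul _) fun s hs => ?_
    rw [← ENNReal.ofReal_mul (hg0 _), ← ENNReal.ofReal_mul (hf0 _)]
    refine ENNReal.ofReal_le_ofReal ?_
    have := h s t (le_trans hs (le_of_lt ht))
    linarith
  rw [← Set.compl_Iic, prob_compl_eq_one_sub measurableSet_Iic,
    prob_compl_eq_one_sub measurableSet_Iic] at key
  set a := (volume.withDensity fun x => ENNReal.ofReal (f x)) (Set.Iic x)
  set b := (volume.withDensity fun x => ENNReal.ofReal (g x)) (Set.Iic x)
  have ha : a ≤ 1 := prob_le_one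
  have hb : b ≤ 1 := prob_le_one
  have ha' : a ≠ ∞ := ne_top_of_le_ne_top ENNReal.one_ne_top ha
  have hb' : b ≠ ∞ := ne_top_of_le_ne_top ENNReal.one_ne_top hb
  have key' := ENNReal.toReal_mono (by finiteness) key
  rw [ENNReal.toReal_mul, ENNReal.toReal_mul, ENNReal.toReal_sub_of_le hb ENNReal.one_ne_top,
    ENNReal.toReal_sub_of_le ha ENNReal.one_ne_top] at key'
  rw [← ENNReal.toReal_le_toReal ha' hb']
  simp only [ENNReal.toReal_one] at key'
  nlinarith

lemma withDensity_shift_Iic (f : ℝ → ℝ) (δ x : ℝ) :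
    (volume.withDensity fun x => ENNReal.ofReal (f (x - δ))) (Set.Iic x) =
      (volume.withDensity fun x => ENNReal.ofReal (f x)) (Set.Iic (x - δ)) := by
  rw [withDensity_apply _ measurableSet_Iic, withDensity_apply _ measurableSet_Iic,
    ← lintegral_indicator measurableSet_Iic, ← lintegral_indicator measurableSet_Iic,
    ← lintegral_sub_right_eq_self
      (fun t => (Set.Iic (x - δ)).indicator (fun x => ENNReal.ofReal (f x)) t) δ]
  congr with t
  simp [Set.indicator]

lemma isProbabilityMeasure_shift (f : ℝ → ℝ) (δ : ℝ)
    [h : IsProbabilityMeasure (volume.withDensity fun x => ENNReal.ofReal (f x))] :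
    IsProbabilityMeasure (volume.withDensity fun x => ENNReal.ofReal (f (x - δ))) := by
  constructor
  have := h.measure_univ
  rw [withDensity_apply _ MeasurableSet.univ, Measure.restrict_univ] at this ⊢
  rw [← this, ← lintegral_sub_right_eq_self (fun x => ENNReal.ofReal (f x)) δ]

lemma continuous_cdf (ν : Measure ℝ) [IsProbabilityMeasure ν] [NullSingletonClass ν] :
    Continuous (cdf ν) := by
  refine continuous_iff_continuousAt.2 fun x => ?_
  rw [(monotone_cdf ν).continuousAt_iff_leftLim_eq_rightLim, StieltjesFunction.rightLim_eq]
  have h := StieltjesFunction.measure_singleton (cdf ν) x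
  rw [measure_cdf, measure_singleton, eq_comm, ENNReal.ofReal_eq_zero] at h
  exact le_antisymm ((monotone_cdf ν).leftLim_le le_rfl) (by linarith)

lemma strictMono_cdf (ν : Measure ℝ) [IsProbabilityMeasure ν] [ν.IsOpenPosMeasure] :
    StrictMono (cdf ν) := by
  intro x y hxy
  have h : 0 < ν (Set.Ioc x y) :=
    lt_of_lt_of_le ((isOpen_Ioo (a := x) (b := y)).measure_pos ν (Set.nonempty_Ioo.2 hxy))
      (measure_mono Set.Ioo_subset_Ioc_self)
  rw [← measure_cdf ν, StieltjesFunction.measure_Ioc, ENNReal.ofReal_pos] at h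
  linarith

lemma mem_range_cdf (ν : Measure ℝ) [IsProbabilityMeasure ν] [NullSingletonClass ν] {u : ℝ}
    (h0 : 0 < u) (h1 : u < 1) : ∃ y, cdf ν y = u := by
  obtain ⟨a, ha⟩ := ((tendsto_cdf_atBot ν).eventually (gt_mem_nhds h0)).exists
  obtain ⟨b, hb⟩ := ((tendsto_cdf_atTop ν).eventually (lt_mem_nhds h1)).exists
  exact mem_range_of_exists_le_of_exists_ge (continuous_cdf ν) ⟨a, ha.le⟩ ⟨b, hb.le⟩

lemma cdf_mem_Ioo (ν : Measure ℝ) [IsProbabilityMeasure ν] [ν.IsOpenPosMeasure] (x : ℝ) :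
    0 < cdf ν x ∧ cdf ν x < 1 :=
  ⟨(cdf_nonneg ν (x - 1)).trans_lt (strictMono_cdf ν (by linarith)),
    (strictMono_cdf ν (by linarith : x < x + 1)).trans_le (cdf_le_one ν _)⟩

/-- The monotone transport map between two diffuse measures of full support on the line moves
points by at most `δ` if the distribution functions are within horizontal distance `δ`. -/
lemma exists_transport_of_cdf_le (μ ν : Measure ℝ) [IsProbabilityMeasure μ]
    [IsProbabilityMeasure ν] [NullSingletonClass μ] [NullSingletonClass ν] [μ.IsOpenPosMeasure] [ν.IsOpenPosMeasure]
    {δ : ℝ} (h₁ : ∀ x, cdf μ x ≤ cdf ν (x + δ)) (h₂ : ∀ x, cdf ν x ≤ cdf μ (x + δ)) :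
    ∃ T : ℝ → ℝ, MeasurePreserving T μ ν ∧ ∀ x, |T x - x| ≤ δ := by
  choose T hT using fun x => mem_range_cdf ν (cdf_mem_Ioo μ x).1 (cdf_mem_Ioo μ x).2
  choose S hS using fun x => mem_range_cdf μ (cdf_mem_Ioo ν x).1 (cdf_mem_Ioo ν x).2
  have hmono : Monotone T := fun x y hxy => by
    rw [← (strictMono_cdf ν).le_iff_le, hT, hT]
    exact monotone_cdf μ hxy
  refine ⟨T, ⟨hmono.measurable, ?_⟩, fun x => abs_le.2 ⟨?_, ?_⟩⟩
  · have := Measure.isProbabilityMeasure_map (μ := μ) hmono.measurable.aemeasurable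
    refine Measure.ext_of_Iic _ _ fun y => ?_
    rw [Measure.map_apply hmono.measurable measurableSet_Iic]
    have : T ⁻¹' Set.Iic y = Set.Iic (S y) := by
      ext x
      rw [Set.mem_preimage, Set.mem_Iic, Set.mem_Iic, ← (strictMono_cdf ν).le_iff_le, hT, ← hS,
        (strictMono_cdf μ).le_iff_le]
    rw [this, ← ofReal_cdf, ← ofReal_cdf, hS]
  · have : x ≤ T x + δ := by
      rw [← (strictMono_cdf μ).le_iff_le, ← hT]
      exact h₂ _
    linarith
  · have : T x ≤ x + δ := by
      rw [← (strictMono_cdf ν).le_iff_le, hT]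
      exact h₁ _
    linarith

/-- The `W_∞` distance between two positive densities on the line, one of which has
`ℓ`-strongly monotone negative score, is at most `D / ℓ` when the scores differ by at most `D`. -/
lemma exists_transport_of_score_le {f g S R : ℝ → ℝ} (hf0 : ∀ x, 0 < f x) (hg0 : ∀ x, 0 < g x)
    (hf : ∀ x, HasDerivAt (fun u => Real.log (f u)) (-S x) x)
    (hg : ∀ x, HasDerivAt (fun u => Real.log (g u)) (-R x) x)
    (hfc : Continuous f) (hgc : Continuous g)
    [IsProbabilityMeasure (volume.withDensity fun x => ENNReal.ofReal (f x))]
    [IsProbabilityMeasure (volume.withDensity fun x => ENNReal.ofReal (g x))]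
    {ℓ D : ℝ} (hℓ : 0 < ℓ) (hD : ∀ x, |S x - R x| ≤ D)
    (hS : ∀ s t, s ≤ t → ℓ * (t - s) ≤ S t - S s)
    (hR : ∀ s t, s ≤ t → ℓ * (t - s) ≤ R t - R s) :
    ∃ T : ℝ → ℝ, MeasurePreserving T (volume.withDensity fun x => ENNReal.ofReal (f x))
      (volume.withDensity fun x => ENNReal.ofReal (g x)) ∧ ∀ x, |T x - x| ≤ D / ℓ := by
  have hD0 : 0 ≤ D := (abs_nonneg _).trans (hD 0)
  have hpos : ∀ {q : ℝ → ℝ}, (∀ x, 0 < q x) → Continuous q →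
      (volume.withDensity fun x => ENNReal.ofReal (q x)).IsOpenPosMeasure := fun {q} hq hqc =>
    (withDensity_absolutelyContinuous' (μ := volume) (f := fun x => ENNReal.ofReal (q x))
      hqc.measurable.ennreal_ofReal.aemeasurable
      (.of_forall fun x => (ENNReal.ofReal_pos.2 (hq x)).ne')).isOpenPosMeasure
  have main : ∀ {f g S R : ℝ → ℝ}, (∀ x, 0 < f x) → (∀ x, 0 < g x) →
      (∀ x, HasDerivAt (fun u => Real.log (f u)) (-S x) x) →
      (∀ x, HasDerivAt (fun u => Real.log (g u)) (-R x) x) →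
      Continuous f → Continuous g →
      IsProbabilityMeasure (volume.withDensity fun x => ENNReal.ofReal (f x)) →
      IsProbabilityMeasure (volume.withDensity fun x => ENNReal.ofReal (g x)) →
      (∀ x, |S x - R x| ≤ D) → (∀ s t, s ≤ t → ℓ * (t - s) ≤ S t - S s) → ∀ x,
      cdf (volume.withDensity fun x => ENNReal.ofReal (f x)) x ≤
        cdf (volume.withDensity fun x => ENNReal.ofReal (g x)) (x + D / ℓ) := by
    intro f g S R hf0 hg0 hf hg hfc hgc _ _ hD hS x
    have := isProbabilityMeasure_shift f (D / ℓ)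
    have key := measure_Iic_le_of_likelihoodRatio (f := fun x => f (x - D / ℓ)) (g := g)
      (by fun_prop) (by fun_prop) (fun x => (hf0 _).le) (fun x => (hg0 _).le) ?_ (x + D / ℓ)
    · rw [withDensity_shift_Iic, add_sub_cancel_right] at key
      rw [cdf_eq_real, cdf_eq_real]
      exact ENNReal.toReal_mono (measure_ne_top _ _) key
    · have hanti : Antitone fun x => Real.log (g x) - Real.log (f (x - D / ℓ)) := by
        refine antitone_of_hasDerivAt_nonpos
          (f' := fun x => -R x - -S (x - D / ℓ)) (fun x => ?_) (fun x => ?_)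
        · have := (hf (x - D / ℓ)).comp_sub_const x (D / ℓ)
          exact (hg x).sub this
        · have h1 := hS (x - D / ℓ) x (by have := div_nonneg hD0 hℓ.le; linarith)
          have h2 : ℓ * (x - (x - D / ℓ)) = D := by field_simp; ring
          have h3 := (abs_le.1 (hD x)).2
          simp only [Pi.zero_apply]
          linarith
      intro s t hst
      have h1 := hanti hst
      simp only at h1
      have h2 : Real.log (g t * f (s - D / ℓ)) ≤ Real.log (g s * f (t - D / ℓ)) := by
        rw [Real.log_mul (hg0 _).ne' (hf0 _).ne', Real.log_mul (hg0 _).ne' (hf0 _).ne']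
        linarith
      exact (Real.log_le_log_iff (mul_pos (hg0 _) (hf0 _)) (mul_pos (hg0 _) (hf0 _))).1 h2
  have := hpos hf0 hfc
  have := hpos hg0 hgc
  exact exists_transport_of_cdf_le _ _
    (main hf0 hg0 hf hg hfc hgc inferInstance inferInstance hD hS)
    (main hg0 hf0 hg hf hgc hfc inferInstance inferInstance
      (fun x => by rw [abs_sub_comm]; exact hD x) hR)

section Pi

variable {ι : Type*} [Fintype ι] [DecidableEq ι]

/-- Resampling one coordinate independently preserves a product probability measure. -/
lemma measurePreserving_update_pi (ν : ι → Measure ℝ) [∀ j, IsProbabilityMeasure (ν j)] (i : ι) :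
    MeasurePreserving (fun y : ℝ × (ι → ℝ) => Function.update y.2 i y.1)
      ((ν i).prod (Measure.pi ν)) (Measure.pi ν) := by
  have hm : Measurable fun y : ℝ × (ι → ℝ) => Function.update y.2 i y.1 := by
    refine measurable_pi_lambda _ fun j => ?_
    by_cases h : j = i
    · subst h; simpa using measurable_fst
    · simp only [Function.update_of_ne h]
      exact (measurable_pi_apply j).comp measurable_snd
  refine ⟨hm, (Measure.pi_eq fun s hs => ?_).symm⟩
  rw [Measure.map_apply hm (MeasurableSet.univ_pi hs)]
  have : (fun y : ℝ × (ι → ℝ) => Function.update y.2 i y.1) ⁻¹' (Set.univ.pi s) =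
      s i ×ˢ (Set.univ.pi (Function.update s i Set.univ)) := by
    ext ⟨t, x⟩
    simp only [Set.mem_preimage, Set.mem_pi, Set.mem_univ, true_implies, Set.mem_prod]
    constructor
    · intro h
      refine ⟨by simpa using h i, fun j => ?_⟩
      by_cases hj : j = i
      · subst hj; simp
      · simpa [hj] using h j
    · rintro ⟨h1, h2⟩ j
      by_cases hj : j = i
      · subst hj; simpa using h1
      · simpa [hj] using h2 j
  rw [this, Measure.prod_prod, Measure.pi_pi, ← Finset.mul_prod_erase Finset.univ _
    (Finset.mem_univ i), ← Finset.mul_prod_erase Finset.univ (fun j => ν j (s j))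
    (Finset.mem_univ i)]
  simp only [Function.update_self, measure_univ, one_mul]
  congr 1
  refine Finset.prod_congr rfl fun j hj => ?_
  rw [Function.update_of_ne (Finset.ne_of_mem_erase hj)]

lemma integral_pi_eq_integral_update (ν : ι → Measure ℝ) [∀ j, IsProbabilityMeasure (ν j)] (i : ι)
    {f : (ι → ℝ) → ℝ} (hf : Integrable f (Measure.pi ν)) :
    ∫ x, f x ∂Measure.pi ν = ∫ t, ∫ x, f (Function.update x i t) ∂Measure.pi ν ∂ν i := by
  have hp := measurePreserving_update_pi ν i
  have h1 : Integrable (fun y : ℝ × (ι → ℝ) => f (Function.update y.2 i y.1))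
    ((ν i).prod (Measure.pi ν)) := hp.integrable_comp_of_integrable hf
  rw [← integral_prod _ h1, ← hp.map_eq, integral_map hp.measurable.aemeasurable
    (by rw [hp.map_eq]; exact hf.aestronglyMeasurable), hp.map_eq]

lemma integrable_integral_update (ν : ι → Measure ℝ) [∀ j, IsProbabilityMeasure (ν j)] (i : ι)
    {f : (ι → ℝ) → ℝ} (hf : Integrable f (Measure.pi ν)) :
    Integrable (fun t => ∫ x, f (Function.update x i t) ∂Measure.pi ν) (ν i) :=
  ((measurePreserving_update_pi ν i).integrable_comp_of_integrable hf).integral_prod_left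

lemma ae_integrable_update (ν : ι → Measure ℝ) [∀ j, IsProbabilityMeasure (ν j)] (i : ι)
    {f : (ι → ℝ) → ℝ} (hf : Integrable f (Measure.pi ν)) :
    ∀ᵐ t ∂ν i, Integrable (fun x => f (Function.update x i t)) (Measure.pi ν) :=
  ((measurePreserving_update_pi ν i).integrable_comp_of_integrable hf).prod_right_ae

lemma ae_ae_update (ν : ι → Measure ℝ) [∀ j, IsProbabilityMeasure (ν j)] (i : ι)
    {P : (ι → ℝ) → Prop} (hP : ∀ᵐ x ∂Measure.pi ν, P x) :
    ∀ᵐ t ∂ν i, ∀ᵐ x ∂Measure.pi ν, P (Function.update x i t) :=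
  Measure.ae_ae_of_ae_prod ((measurePreserving_update_pi ν i).quasiMeasurePreserving.ae hP)

end Pi

section PiKernel

variable {ι : Type*} [Fintype ι]

lemma pi_withDensity_ofReal (μ : ι → Measure ℝ) [∀ j, SigmaFinite (μ j)] (f : ι → ℝ → ℝ)
    (hf0 : ∀ j x, 0 ≤ f j x) (hf : ∀ j, Integrable (f j) (μ j)) :
    Measure.pi (fun j => (μ j).withDensity fun t => ENNReal.ofReal (f j t)) =
      (Measure.pi μ).withDensity fun x => ENNReal.ofReal (∏ j, f j (x j)) := by
  have : ∀ j, IsFiniteMeasure ((μ j).withDensity fun t => ENNReal.ofReal (f j t)) :=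
    fun j => isFiniteMeasure_withDensity_ofReal (hf j).2
  refine Measure.pi_eq fun s hs => ?_
  have h0 : ∀ j x, 0 ≤ (s j).indicator (f j) x := fun j x =>
    Set.indicator_nonneg (fun x _ => hf0 j x) x
  have hI : ∀ j, Integrable ((s j).indicator (f j)) (μ j) := fun j => (hf j).indicator (hs j)
  rw [withDensity_apply _ (MeasurableSet.univ_pi hs),
    ← lintegral_indicator (MeasurableSet.univ_pi hs)]
  have e1 : (Set.univ.pi s).indicator (fun x => ENNReal.ofReal (∏ j, f j (x j))) =
      fun x => ENNReal.ofReal (∏ j, (s j).indicator (f j) (x j)) := by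
    classical
    ext x
    by_cases hx : x ∈ Set.univ.pi s
    · rw [Set.indicator_of_mem hx]
      congr 1
      exact Finset.prod_congr rfl fun j _ => by rw [Set.indicator_of_mem (hx j (Set.mem_univ j))]
    · rw [Set.indicator_of_notMem hx]
      simp only [Set.mem_pi, Set.mem_univ, true_implies, not_forall] at hx
      obtain ⟨j, hj⟩ := hx
      rw [Finset.prod_eq_zero (Finset.mem_univ j) (Set.indicator_of_notMem hj _),
        ENNReal.ofReal_zero]
  rw [e1, ← ofReal_integral_eq_lintegral_ofReal (Integrable.fintype_prod hI)
    (.of_forall fun x => Finset.prod_nonneg fun j _ => h0 j _),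
    integral_fintype_prod_eq_prod, ENNReal.ofReal_prod_of_nonneg
    (fun j _ => integral_nonneg (h0 j))]
  refine Finset.prod_congr rfl fun j _ => ?_
  rw [withDensity_apply _ (hs j), ← lintegral_indicator (hs j),
    ofReal_integral_eq_lintegral_ofReal (hI j) (.of_forall (h0 j))]
  congr with x
  by_cases hx : x ∈ s j <;> simp [hx]

/-- The product of finitely many Markov kernels with the same source. -/
noncomputable def piKernel (κ : ι → Kernel ℝ ℝ) [∀ j, IsMarkovKernel (κ j)] :
    Kernel ℝ (ι → ℝ) where
  toFun a := Measure.pi fun j => κ j a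
  measurable' := by
    refine Measurable.measure_of_isPiSystem_of_isProbabilityMeasure generateFrom_pi.symm
      isPiSystem_pi ?_
    rintro _ ⟨s, hs, rfl⟩
    simp only [Measure.pi_pi]
    exact Finset.measurable_prod _ fun j _ => (κ j).measurable_coe (hs j (Set.mem_univ j))

lemma piKernel_apply (κ : ι → Kernel ℝ ℝ) [∀ j, IsMarkovKernel (κ j)] (a : ℝ) :
    piKernel κ a = Measure.pi fun j => κ j a := rfl

instance (κ : ι → Kernel ℝ ℝ) [∀ j, IsMarkovKernel (κ j)] : IsMarkovKernel (piKernel κ) :=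
  ⟨fun a => by rw [piKernel_apply]; infer_instance⟩

end PiKernel

lemma starMeasure_eq_compProd {k : ℕ} (p : Measure ℝ) [IsProbabilityMeasure p]
    (κ : Fin k → Kernel ℝ ℝ) [∀ j, IsMarkovKernel (κ j)] :
    starMeasure p κ = p ⊗ₘ piKernel κ := by
  rw [Measure.compProd_eq_comp_prod]
  unfold starMeasure
  congr with a s hs
  rw [Kernel.prod_apply, Kernel.id_apply, piKernel_apply]

lemma isStar_compProd {k : ℕ} (p : Measure ℝ) [IsProbabilityMeasure p]
    (κ : Fin k → Kernel ℝ ℝ) [∀ j, IsMarkovKernel (κ j)] :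
    IsStar (p ⊗ₘ piKernel κ) :=
  ⟨inferInstance, p, κ, inferInstance, fun _ => inferInstance, (starMeasure_eq_compProd p κ).symm⟩

lemma integrable_norm_pi {ι : Type*} [Fintype ι] (ν : ι → Measure ℝ)
    [∀ j, IsProbabilityMeasure (ν j)] (h : ∀ j, Integrable (fun t => |t|) (ν j)) :
    Integrable (fun x : ι → ℝ => ‖x‖) (Measure.pi ν) := by
  have h1 : Integrable (fun x : ι → ℝ => ∑ j, |x j|) (Measure.pi ν) :=
    integrable_finsetSum _ fun j _ => (measurePreserving_eval ν j).integrable_comp_of_integrable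
      (h j)
  refine h1.mono' (by fun_prop) (.of_forall fun x => ?_)
  rw [norm_norm]
  refine (pi_norm_le_iff_of_nonneg (Finset.sum_nonneg fun j _ => abs_nonneg _)).2 fun j => ?_
  exact Finset.single_le_sum (f := fun j => |x j|) (fun j _ => abs_nonneg _) (Finset.mem_univ j)

/-- A strongly log-concave density has a first moment. -/
lemma integrable_abs_of_strongly_logConcave {f S : ℝ → ℝ} (hf0 : ∀ x, 0 < f x)
    (hfc : Continuous f) (hf : ∀ x, HasDerivAt (fun u => Real.log (f u)) (-S x) x)
    {ℓ : ℝ} (hℓ : 0 < ℓ) (hS : ∀ s t, s ≤ t → ℓ * (t - s) ≤ S t - S s) :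
    Integrable (fun t => |t|) (volume.withDensity fun x => ENNReal.ofReal (f x)) := by
  have hbound : ∀ x, Real.log (f x) + ℓ / 2 * x ^ 2 ≤ Real.log (f 0) - S 0 * x := by
    have hd : ∀ x, HasDerivAt (fun u => Real.log (f u) + ℓ / 2 * u ^ 2 + S 0 * u)
        (-S x + ℓ / 2 * (2 * x) + S 0) x := fun x => by
      have h1 := ((hf x).add (((hasDerivAt_id x).pow 2).const_mul (ℓ / 2))).add
        ((hasDerivAt_id x).const_mul (S 0))
      exact h1.congr_deriv (by simp)
    intro x
    rcases le_total 0 x with hx | hx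
    · have := antitoneOn_of_hasDerivWithinAt_nonpos (convex_Ici 0)
        (fun y _ => (hd y).continuousAt.continuousWithinAt)
        (fun y _ => (hd y).hasDerivWithinAt) (fun y hy => by
          rw [interior_Ici] at hy
          have := hS 0 y (le_of_lt hy)
          linarith) (Set.self_mem_Ici) (Set.mem_Ici.2 hx) hx
      simp only [mul_zero, add_zero, ne_eq, OfNat.ofNat_ne_zero, not_false_eq_true, zero_pow]
        at this
      linarith
    · have := monotoneOn_of_hasDerivWithinAt_nonneg (convex_Iic 0)
        (fun y _ => (hd y).continuousAt.continuousWithinAt)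
        (fun y _ => (hd y).hasDerivWithinAt) (fun y hy => by
          rw [interior_Iic] at hy
          have := hS y 0 (le_of_lt hy)
          linarith) (Set.mem_Iic.2 hx) (Set.self_mem_Iic) hx
      simp only [mul_zero, add_zero, ne_eq, OfNat.ofNat_ne_zero, not_false_eq_true, zero_pow]
        at this
      linarith
  have hle : ∀ x, f x ≤ (f 0 * Real.exp (S 0 ^ 2 / ℓ)) * Real.exp (-(ℓ / 4) * x ^ 2) := by
    intro x
    rw [← Real.log_le_log_iff (hf0 x) (by have := hf0 0; positivity), Real.log_mul
      (by have := hf0 0; positivity) (by positivity), Real.log_mul (hf0 0).ne' (by positivity),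
      Real.log_exp, Real.log_exp]
    have h1 := hbound x
    have h2 : 0 ≤ (S 0 + ℓ / 2 * x) ^ 2 / ℓ := by positivity
    have h3 : (S 0 + ℓ / 2 * x) ^ 2 / ℓ = S 0 ^ 2 / ℓ + S 0 * x + ℓ / 4 * x ^ 2 := by
      field_simp; ring
    linarith
  rw [integrable_withDensity_iff hfc.measurable.ennreal_ofReal (.of_forall fun x => by simp)]
  have h_intg : Integrable fun x : ℝ => |x * Real.exp (-(ℓ / 4) * x ^ 2)| :=
    (integrable_mul_exp_neg_mul_sq (by positivity : 0 < ℓ / 4)).abs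
  refine (h_intg.const_mul (f 0 * Real.exp (S 0 ^ 2 / ℓ))).mono'
    (continuous_abs.measurable.mul hfc.measurable.ennreal_ofReal.ennreal_toReal).aestronglyMeasurable
    (.of_forall fun x => ?_)
  rw [ENNReal.toReal_ofReal (hf0 x).le, Real.norm_eq_abs, abs_mul, abs_abs, abs_of_pos (hf0 x),
    abs_mul, abs_of_pos (Real.exp_pos _)]
  calc |x| * f x ≤ |x| * _ := mul_le_mul_of_nonneg_left (hle x) (abs_nonneg x)
    _ = _ := by ring

/-- A continuous function agreeing a.e. on its positivity set with a positive continuous function,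
and positive somewhere, agrees with it everywhere. -/
lemma eq_of_ae_eq_on_pos {q E : ℝ → ℝ} (hq : Continuous q) (hE : Continuous E)
    (hE0 : ∀ t, 0 < E t) {t₀ : ℝ} (h0 : 0 < q t₀) (h : ∀ᵐ t, 0 < q t → q t = E t) :
    q = E := by
  have hU : IsOpen {t | 0 < q t} := isOpen_lt continuous_const hq
  have h1 : Set.EqOn q E {t | 0 < q t} :=
    Measure.eqOn_open_of_ae_eq (μ := volume)
      ((ae_restrict_iff' hU.measurableSet).2 h) hU hq.continuousOn hE.continuousOn
  have h2 : {t | 0 < q t} = {t | q t = E t} := by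
    ext t
    exact ⟨fun ht => h1 ht, fun ht => by
      change 0 < q t
      rw [show q t = E t from ht]
      exact hE0 t⟩
  have h3 : IsClopen {t | 0 < q t} := ⟨by rw [h2]; exact isClosed_eq hq hE, hU⟩
  have h4 := h3.eq_univ ⟨t₀, h0⟩
  rw [h2] at h4
  ext t
  exact (Set.eq_univ_iff_forall.1 h4) t

section Family

variable {Ω : Type*} [MeasurableSpace Ω] {P : Measure Ω} [IsFiniteMeasure P]

/-- Differentiation under the integral sign for increments of a family of functions with
uniformly Lipschitz derivative. -/
lemma hasDerivAt_integral_sub {F G : ℝ → Ω → ℝ} (hFm : ∀ t, AEStronglyMeasurable (F t) P)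
    (hGm : ∀ t, AEStronglyMeasurable (G t) P)
    (hF : ∀ t x, HasDerivAt (fun u => F u x) (G t x) t) {L : ℝ}
    (hL : ∀ s t x, |G t x - G s x| ≤ L * |t - s|) {t₀ t₁ : ℝ} (hne : t₁ ≠ t₀)
    (h_intg : Integrable (fun x => F t₁ x - F t₀ x) P) :
    (∀ t, Integrable (G t) P) ∧
      ∀ t, HasDerivAt (fun u => ∫ x, (F u x - F t₀ x) ∂P) (∫ x, G t x ∂P) t := by
  have taylor : ∀ s t x, |F t x - F s x - G s x * (t - s)| ≤ L * |t - s| * |t - s| := by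
    intro s t x
    have hd : ∀ u ∈ Set.uIcc s t, HasDerivWithinAt (fun u => F u x - G s x * u)
        (G u x - G s x * 1) (Set.uIcc s t) u := fun u _ =>
      ((hF u x).sub ((hasDerivAt_id u).const_mul (G s x))).hasDerivWithinAt
    have hL0 : 0 ≤ L := by
      have := (abs_nonneg _).trans (hL 0 1 x)
      simpa using this
    have hb : ∀ u ∈ Set.uIcc s t, ‖G u x - G s x * 1‖ ≤ L * |t - s| := fun u hu => by
      rw [mul_one, Real.norm_eq_abs]
      exact (hL s u x).trans (mul_le_mul_of_nonneg_left (Set.abs_sub_left_of_mem_uIcc hu) hL0)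
    have := (convex_uIcc s t).norm_image_sub_le_of_norm_hasDerivWithin_le hd hb
      Set.left_mem_uIcc Set.right_mem_uIcc
    simp only [Real.norm_eq_abs] at this
    convert this using 2
    ring
  have hG₀ : Integrable (G t₀) P := by
    have h1 : Integrable (fun x => G t₀ x * (t₁ - t₀)) P := by
      refine ((h_intg.norm).add (integrable_const (L * |t₁ - t₀| * |t₁ - t₀|))).mono'
        ((hGm t₀).mul_const _) (.of_forall fun x => ?_)
      have h2 := taylor t₀ t₁ x
      simp only [Real.norm_eq_abs, Pi.add_apply]
      have h3 : G t₀ x * (t₁ - t₀) =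
          (F t₁ x - F t₀ x) - (F t₁ x - F t₀ x - G t₀ x * (t₁ - t₀)) := by ring
      rw [h3]
      exact (abs_sub _ _).trans (add_le_add le_rfl h2)
    have h2 := h1.div_const (t₁ - t₀)
    simpa [mul_div_assoc, div_self (sub_ne_zero.2 hne)] using h2
  have hG : ∀ t, Integrable (G t) P := fun t => by
    refine (hG₀.norm.add (integrable_const (L * |t - t₀|))).mono' (hGm t) (.of_forall fun x => ?_)
    have h1 := hL t₀ t x
    simp only [Real.norm_eq_abs, Pi.add_apply]
    have h3 : G t x = G t₀ x + (G t x - G t₀ x) := by ring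
    rw [h3]
    exact (abs_add_le _ _).trans (by simpa using h1)
  have hFint : ∀ t, Integrable (fun x => F t x - F t₀ x) P := fun t => by
    refine ((hG₀.norm.mul_const |t - t₀|).add
      (integrable_const (L * |t - t₀| * |t - t₀|))).mono' ((hFm t).sub (hFm t₀))
      (.of_forall fun x => ?_)
    have h2 := taylor t₀ t x
    simp only [Real.norm_eq_abs, Pi.add_apply]
    have h3 : F t x - F t₀ x =
        G t₀ x * (t - t₀) + (F t x - F t₀ x - G t₀ x * (t - t₀)) := by ring
    rw [h3]
    refine (abs_add_le _ _).trans ?_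
    rw [abs_mul]
    linarith
  refine ⟨hG, fun t => ?_⟩
  refine (hasDerivAt_integral_of_dominated_loc_of_deriv_le
    (s := Metric.ball t 1) (bound := fun x => ‖G t x‖ + |L|)
    (F := fun u x => F u x - F t₀ x) (F' := G)
    (Metric.ball_mem_nhds t one_pos) (.of_forall fun u => (hFm u).sub (hFm t₀)) (hFint t) (hGm t)
    (.of_forall fun x u hu => ?_) ((hG t).norm.add (integrable_const |L|))
    (.of_forall fun x u _ => (hF u x).sub_const _)).2
  have h1 := hL t u x
  have hu' : |u - t| < 1 := by simpa [Real.dist_eq] using hu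
  have h3 : G u x = G t x + (G u x - G t x) := by ring
  rw [h3]
  refine (norm_add_le _ _).trans (add_le_add le_rfl ?_)
  rw [Real.norm_eq_abs]
  refine h1.trans ?_
  calc L * |u - t| ≤ |L| * |u - t| := mul_le_mul_of_nonneg_right (le_abs_self L) (abs_nonneg _)
    _ ≤ |L| * 1 := mul_le_mul_of_nonneg_left hu'.le (abs_nonneg _)
    _ = |L| := mul_one _

end Family

section MeanField

variable {ι : Type*} [Fintype ι] [DecidableEq ι]

/-- The mean-field equations: if averaging the log-likelihood ratio `∑ log q_j + v` over all
coordinates except the `i`-th gives an a.e. constant, then `q_i` is positive and its logarithmic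
derivative is minus the averaged partial derivative of `v`. -/
lemma meanField_score {v : (ι → ℝ) → ℝ} {i : ι} {w : (ι → ℝ) → ℝ} (hv : Continuous v)
    (hw : Continuous w)
    (hvw : ∀ x t, HasDerivAt (fun u => v (Function.update x i u)) (w (Function.update x i t)) t)
    {L : ℝ} (hL : ∀ x s t, |w (Function.update x i t) - w (Function.update x i s)| ≤ L * |t - s|)
    {ν : ι → Measure ℝ} [∀ j, IsProbabilityMeasure (ν j)] {q : ι → ℝ → ℝ}
    (hq : ∀ j, Continuous (q j))
    (hν : ∀ j, ν j = volume.withDensity fun t => ENNReal.ofReal (q j t))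
    {f : (ι → ℝ) → ℝ} (hf : Integrable f (Measure.pi ν)) {C : ℝ}
    (hfeq : ∀ᵐ x ∂Measure.pi ν, f x = C + ∑ j, Real.log (q j (x j)) + v x) {c : ℝ}
    (hc : ∀ᵐ t ∂ν i, ∫ x, f (Function.update x i t) ∂Measure.pi ν = c) :
    (∀ t, 0 < q i t) ∧ (∀ t, Integrable (fun x => w (Function.update x i t)) (Measure.pi ν)) ∧
      ∀ t, HasDerivAt (fun u => Real.log (q i u))
        (-∫ x, w (Function.update x i t) ∂Measure.pi ν) t := by
  have hum : ∀ t, Continuous fun x : ι → ℝ => Function.update x i t := fun t =>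
    continuous_id.update i continuous_const
  have hpos : ∀ᵐ t ∂ν i, 0 < q i t := by
    rw [hν i, ae_withDensity_iff (hq i).measurable.ennreal_ofReal]
    exact .of_forall fun t ht => ENNReal.ofReal_pos.1 (pos_iff_ne_zero.2 ht)
  let Good : ℝ → Prop := fun t =>
    0 < q i t ∧ (∫ x, f (Function.update x i t) ∂Measure.pi ν = c) ∧
      Integrable (fun x => f (Function.update x i t)) (Measure.pi ν) ∧
      ∀ᵐ x ∂Measure.pi ν, f (Function.update x i t) =
        (C + ∑ j ∈ Finset.univ.erase i, Real.log (q j (x j))) + Real.log (q i t) +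
          v (Function.update x i t)
  have hgood : ∀ᵐ t ∂ν i, Good t := by
    filter_upwards [hpos, hc, ae_integrable_update ν i hf, ae_ae_update ν i hfeq]
      with t h1 h2 h3 h4
    refine ⟨h1, h2, h3, h4.mono fun x hx => ?_⟩
    rw [hx, ← Finset.add_sum_erase _ _ (Finset.mem_univ i), Function.update_self]
    have : ∑ j ∈ Finset.univ.erase i, Real.log (q j (Function.update x i t j)) =
        ∑ j ∈ Finset.univ.erase i, Real.log (q j (x j)) :=
      Finset.sum_congr rfl fun j hj => by rw [Function.update_of_ne (Finset.ne_of_mem_erase hj)]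
    rw [this]
    ring
  have hdiff : ∀ {s t}, Good s → Good t →
      Integrable (fun x => v (Function.update x i t) - v (Function.update x i s))
        (Measure.pi ν) ∧
      Real.log (q i t) = Real.log (q i s) -
        ∫ x, (v (Function.update x i t) - v (Function.update x i s)) ∂Measure.pi ν :=
    fun {s t} hs ht => by
      have hae : (fun x => f (Function.update x i t) - f (Function.update x i s) -
          (Real.log (q i t) - Real.log (q i s))) =ᵐ[Measure.pi ν]
          fun x => v (Function.update x i t) - v (Function.update x i s) := by
        filter_upwards [hs.2.2.2, ht.2.2.2] with x h1 h2
        rw [h1, h2]; ring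
      have hI : Integrable (fun x => f (Function.update x i t) - f (Function.update x i s) -
          (Real.log (q i t) - Real.log (q i s))) (Measure.pi ν) := (ht.2.2.1.sub hs.2.2.1).sub
        (integrable_const (μ := Measure.pi ν) (Real.log (q i t) - Real.log (q i s)))
      refine ⟨hI.congr hae, ?_⟩
      rw [← integral_congr_ae hae, integral_sub
        (f := fun x => f (Function.update x i t) - f (Function.update x i s))
        (ht.2.2.1.sub hs.2.2.1) (integrable_const _), integral_sub ht.2.2.1 hs.2.2.1, hs.2.1, ht.2.1]
      simp
  have : NullSingletonClass (ν i) := by rw [hν i]; infer_instance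
  obtain ⟨t₀, h₀⟩ := hgood.exists
  obtain ⟨t₁, h₁, hne⟩ := (hgood.and (measure_eq_zero_iff_ae_notMem.1
    (measure_singleton (μ := ν i) t₀))).exists
  obtain ⟨h_intg, hder⟩ := hasDerivAt_integral_sub (P := Measure.pi ν)
    (F := fun t x => v (Function.update x i t)) (G := fun t x => w (Function.update x i t))
    (fun t => (hv.comp (hum t)).aestronglyMeasurable)
    (fun t => (hw.comp (hum t)).aestronglyMeasurable) (fun t x => hvw x t)
    (fun s t x => hL x s t) hne (hdiff h₀ h₁).1
  set W : ℝ → ℝ := fun t =>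
    ∫ x, (v (Function.update x i t) - v (Function.update x i t₀)) ∂Measure.pi ν with hW
  have hWc : Continuous W := continuous_iff_continuousAt.2 fun t => (hder t).continuousAt
  have hqE : q i = fun t => q i t₀ * Real.exp (-W t) := by
    refine eq_of_ae_eq_on_pos (hq i) (by fun_prop)
      (fun t => mul_pos h₀.1 (Real.exp_pos _)) h₀.1 ?_
    have h2 := hgood
    rw [hν i, ae_withDensity_iff (hq i).measurable.ennreal_ofReal] at h2
    filter_upwards [h2] with t ht hqt
    have ht' := ht (ENNReal.ofReal_pos.2 hqt).ne'
    rw [← Real.exp_log hqt, ((hdiff h₀) ht').2, sub_eq_add_neg, Real.exp_add,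
      Real.exp_log h₀.1]
  have hqpos : ∀ t, 0 < q i t := fun t => by
    rw [hqE]; exact mul_pos h₀.1 (Real.exp_pos _)
  refine ⟨hqpos, h_intg, fun t => ?_⟩
  have : (fun u => Real.log (q i u)) = fun u => Real.log (q i t₀) + -W u := by
    ext u
    conv_lhs => rw [hqE]
    rw [Real.log_mul h₀.1.ne' (Real.exp_pos _).ne', Real.log_exp]
  rw [this]
  exact ((hder t).neg).const_add _

end MeanField

section Comparison

variable {ι : Type*} [Fintype ι] [DecidableEq ι]

lemma integral_score_mono {ν : ι → Measure ℝ} [∀ j, IsProbabilityMeasure (ν j)] {i : ι}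
    {w : (ι → ℝ) → ℝ} {ℓ : ℝ}
    (hmono : ∀ x s t, s ≤ t →
      ℓ * (t - s) ≤ w (Function.update x i t) - w (Function.update x i s))
    (h_intg : ∀ t, Integrable (fun x => w (Function.update x i t)) (Measure.pi ν)) {s t : ℝ}
    (hst : s ≤ t) :
    ℓ * (t - s) ≤ ∫ x, w (Function.update x i t) ∂Measure.pi ν -
      ∫ x, w (Function.update x i s) ∂Measure.pi ν := by
  rw [← integral_sub (h_intg t) (h_intg s)]
  have := integral_mono (μ := Measure.pi ν) (integrable_const (ℓ * (t - s)))
    ((h_intg t).sub (h_intg s)) (fun x => hmono x s t hst)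
  simpa using this

/-- Two mean-field solutions have scores differing by at most `ℓ A / (ℓ - M)` when the
potentials' partial derivatives differ by at most `A`. The interaction constant `M` is a Lipschitz
constant with respect to the supremum norm, so that the fixed-point argument closes with
`W_∞` transports of the coordinates. -/
lemma abs_meanField_score_sub_le {ν ν' : ι → Measure ℝ} [∀ j, IsProbabilityMeasure (ν j)]
    [∀ j, IsProbabilityMeasure (ν' j)] {q q' : ι → ℝ → ℝ} {w w' : ι → (ι → ℝ) → ℝ}
    (hq : ∀ j, Continuous (q j)) (hq' : ∀ j, Continuous (q' j))
    (hν : ∀ j, ν j = volume.withDensity fun t => ENNReal.ofReal (q j t))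
    (hν' : ∀ j, ν' j = volume.withDensity fun t => ENNReal.ofReal (q' j t))
    (hq0 : ∀ j t, 0 < q j t) (hq0' : ∀ j t, 0 < q' j t)
    (hw' : ∀ i, Continuous (w' i))
    (h_intg : ∀ i t, Integrable (fun x => w i (Function.update x i t)) (Measure.pi ν))
    (h_intg' : ∀ i t, Integrable (fun x => w' i (Function.update x i t)) (Measure.pi ν'))
    (hder : ∀ i t, HasDerivAt (fun u => Real.log (q i u))
      (-∫ x, w i (Function.update x i t) ∂Measure.pi ν) t)
    (hder' : ∀ i t, HasDerivAt (fun u => Real.log (q' i u))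
      (-∫ x, w' i (Function.update x i t) ∂Measure.pi ν') t)
    {ℓ A M : ℝ} (hℓ : 0 < ℓ) (hM0 : 0 ≤ M) (hM : M < ℓ)
    (hmono : ∀ i x s t, s ≤ t →
      ℓ * (t - s) ≤ w i (Function.update x i t) - w i (Function.update x i s))
    (hmono' : ∀ i x s t, s ≤ t →
      ℓ * (t - s) ≤ w' i (Function.update x i t) - w' i (Function.update x i s))
    (hA : ∀ i x, |w i x - w' i x| ≤ A)
    (hlip : ∀ i x y t,
      |w' i (Function.update x i t) - w' i (Function.update y i t)| ≤ M * ‖x - y‖)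
    (i : ι) (t : ℝ) :
    |∫ x, w i (Function.update x i t) ∂Measure.pi ν -
      ∫ x, w' i (Function.update x i t) ∂Measure.pi ν'| ≤ ℓ * A / (ℓ - M) := by
  have hum : ∀ i t, Continuous fun x : ι → ℝ => Function.update x i t := fun i t =>
    continuous_id.update i continuous_const
  set S : ι → ℝ → ℝ := fun i t => ∫ x, w i (Function.update x i t) ∂Measure.pi ν with hS
  set S' : ι → ℝ → ℝ := fun i t => ∫ x, w' i (Function.update x i t) ∂Measure.pi ν' with hS'
  have hSmono : ∀ i s t, s ≤ t → ℓ * (t - s) ≤ S i t - S i s := fun i s t hst =>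
    integral_score_mono (hmono i) (h_intg i) hst
  have hSmono' : ∀ i s t, s ≤ t → ℓ * (t - s) ≤ S' i t - S' i s := fun i s t hst =>
    integral_score_mono (hmono' i) (h_intg' i) hst
  have hA0 : 0 ≤ A := (abs_nonneg _).trans (hA i 0)
  have hcross : ∀ i t, Integrable (fun x => w' i (Function.update x i t)) (Measure.pi ν) :=
    fun i t => by
      refine ((h_intg i t).norm.add (integrable_const A)).mono'
        (((hw' i).comp (hum i t)).aestronglyMeasurable) (.of_forall fun x => ?_)
      have h1 := hA i (Function.update x i t)
      have h2 : w' i (Function.update x i t) = w i (Function.update x i t) -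
          (w i (Function.update x i t) - w' i (Function.update x i t)) := by ring
      simp only [Real.norm_eq_abs, Pi.add_apply]
      rw [h2]
      exact (abs_sub _ _).trans (add_le_add le_rfl h1)
  have hsplit : ∀ i t, |S i t - S' i t| ≤ A + |∫ x, w' i (Function.update x i t) ∂Measure.pi ν -
      S' i t| := fun i t => by
    have h1 : |S i t - ∫ x, w' i (Function.update x i t) ∂Measure.pi ν| ≤ A := by
      rw [hS, ← integral_sub (h_intg i t) (hcross i t), ← Real.norm_eq_abs]
      have h := norm_integral_le_of_norm_le_const (μ := Measure.pi ν) (C := A)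
        (f := fun x => w i (Function.update x i t) - w' i (Function.update x i t))
        (.of_forall fun x => (Real.norm_eq_abs _).le.trans (hA i _))
      simpa using h
    exact (abs_sub_le _ _ _).trans (add_le_add h1 le_rfl)
  have hmom : Integrable (fun x : ι → ℝ => ‖x‖) (Measure.pi ν) :=
    integrable_norm_pi ν fun j => by
      rw [hν j]
      exact integrable_abs_of_strongly_logConcave (hq0 j) (hq j) (hder j) hℓ (hSmono j)
  have hmom' : Integrable (fun x : ι → ℝ => ‖x‖) (Measure.pi ν') :=
    integrable_norm_pi ν' fun j => by
      rw [hν' j]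
      exact integrable_abs_of_strongly_logConcave (hq0' j) (hq' j) (hder' j) hℓ (hSmono' j)
  have hcenter : ∀ (ρ : ι → Measure ℝ) [∀ j, IsProbabilityMeasure (ρ j)],
      Integrable (fun x : ι → ℝ => ‖x‖) (Measure.pi ρ) →
      (∀ i t, Integrable (fun x => w' i (Function.update x i t)) (Measure.pi ρ)) → ∀ i t,
      |∫ x, w' i (Function.update x i t) ∂Measure.pi ρ - w' i (Function.update 0 i t)| ≤
        M * ∫ x, ‖x‖ ∂Measure.pi ρ := by
    intro ρ _ hm hI i t
    have h1 : ∫ x, w' i (Function.update x i t) ∂Measure.pi ρ - w' i (Function.update 0 i t) =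
        ∫ x, (w' i (Function.update x i t) - w' i (Function.update 0 i t)) ∂Measure.pi ρ := by
      rw [integral_sub (hI i t) (integrable_const _)]
      simp
    rw [h1, ← integral_const_mul, ← Real.norm_eq_abs]
    refine norm_integral_le_of_norm_le (hm.const_mul M) (.of_forall fun x => ?_)
    simpa using hlip i x 0 t
  obtain ⟨B, hB⟩ : ∃ B, ∀ j : ι × ℝ, |S j.1 j.2 - S' j.1 j.2| ≤ B := by
    refine ⟨A + (M * ∫ x, ‖x‖ ∂Measure.pi ν + M * ∫ x, ‖x‖ ∂Measure.pi ν'), fun j => ?_⟩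
    refine (hsplit j.1 j.2).trans (add_le_add le_rfl ?_)
    refine (abs_sub_le _ (w' j.1 (Function.update 0 j.1 j.2)) _).trans
      (add_le_add (hcenter ν hmom hcross _ _) ?_)
    rw [abs_sub_comm]
    exact hcenter ν' hmom' h_intg' _ _
  set D : ℝ := ⨆ j : ι × ℝ, |S j.1 j.2 - S' j.1 j.2| with hD
  have hle : ∀ i t, |S i t - S' i t| ≤ D := fun i t =>
    le_ciSup (f := fun j : ι × ℝ => |S j.1 j.2 - S' j.1 j.2|)
      ⟨B, by rintro _ ⟨j, rfl⟩; exact hB j⟩ (i, t)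
  have hD0 : 0 ≤ D := (abs_nonneg _).trans (hle i t)
  have hpr : ∀ j, IsProbabilityMeasure (volume.withDensity fun t => ENNReal.ofReal (q j t)) :=
    fun j => by rw [← hν j]; infer_instance
  have hpr' : ∀ j, IsProbabilityMeasure (volume.withDensity fun t => ENNReal.ofReal (q' j t)) :=
    fun j => by rw [← hν' j]; infer_instance
  choose T hT hTδ using fun j => exists_transport_of_score_le (hq0 j) (hq0' j) (hder j) (hder' j)
    (hq j) (hq' j) hℓ (hle j) (hSmono j) (hSmono' j)
  have hTpi : MeasurePreserving (fun x : ι → ℝ => fun j => T j (x j))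
      (Measure.pi ν) (Measure.pi ν') :=
    measurePreserving_pi ν ν' fun j => by rw [hν j, hν' j]; exact hT j
  have hstep : ∀ i t, |S i t - S' i t| ≤ A + M * (D / ℓ) := fun i t => by
    refine (hsplit i t).trans (add_le_add le_rfl ?_)
    have hc : Continuous fun x => w' i (Function.update x i t) := (hw' i).comp (hum i t)
    have h1 : S' i t = ∫ x, w' i (Function.update (fun j => T j (x j)) i t) ∂Measure.pi ν := by
      rw [hS']
      simp only
      rw [← hTpi.map_eq, integral_map hTpi.measurable.aemeasurable hc.aestronglyMeasurable]
    have h2 : Integrable (fun x => w' i (Function.update (fun j => T j (x j)) i t))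
        (Measure.pi ν) := hTpi.integrable_comp_of_integrable (h_intg' i t)
    rw [h1, ← integral_sub (hcross i t) h2, ← Real.norm_eq_abs]
    suffices h : ∀ x : ι → ℝ, ‖w' i (Function.update x i t) -
        w' i (Function.update (fun j => T j (x j)) i t)‖ ≤ M * (D / ℓ) by
      simpa using norm_integral_le_of_norm_le_const (μ := Measure.pi ν) (.of_forall h)
    intro x
    refine (hlip i x _ t).trans (mul_le_mul_of_nonneg_left ?_ hM0)
    refine (pi_norm_le_iff_of_nonneg (by positivity)).2 fun j => ?_
    rw [Pi.sub_apply, Real.norm_eq_abs, abs_sub_comm]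
    exact hTδ j (x j)
  have hDle : D ≤ A + M * (D / ℓ) := by
    have : Nonempty (ι × ℝ) := ⟨(i, t)⟩
    exact ciSup_le fun j => hstep j.1 j.2
  refine (hle i t).trans ?_
  rw [le_div_iff₀ (by linarith)]
  have h3 : M * (D / ℓ) * ℓ = M * D := by field_simp
  nlinarith

end Comparison

section KullbackLeibler

variable {E : Type*} [MeasurableSpace E] {μ ν π : Measure E}

lemma integral_llr_nonneg [IsProbabilityMeasure μ] [IsProbabilityMeasure π] (h : μ ≪ π)
    (h_intg : Integrable (llr μ π) μ) : 0 ≤ ∫ z, llr μ π z ∂μ := by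
  have := InformationTheory.integral_llr_add_sub_measure_univ_nonneg h h_intg
  simpa using this

lemma KL_of_integrable (h : μ ≪ π) (h_intg : Integrable (llr μ π) μ) :
    KL μ π = ENNReal.ofReal (∫ z, llr μ π z ∂μ) :=
  if_pos ⟨h, h_intg⟩

lemma integral_llr_le_of_KL_le [IsProbabilityMeasure μ] [IsProbabilityMeasure ν]
    [IsProbabilityMeasure π] (hν : ν ≪ π) (h_intg : Integrable (llr ν π) ν)
    (h : KL μ π ≤ KL ν π) :
    μ ≪ π ∧ Integrable (llr μ π) μ ∧ ∫ z, llr μ π z ∂μ ≤ ∫ z, llr ν π z ∂ν := by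
  rw [KL_of_integrable hν h_intg] at h
  have h1 : μ ≪ π ∧ Integrable (llr μ π) μ := by
    by_contra h1
    unfold KL at h
    rw [if_neg (by exact h1)] at h
    exact ENNReal.ofReal_ne_top (top_le_iff.1 h)
  refine ⟨h1.1, h1.2, ?_⟩
  rw [KL_of_integrable h1.1 h1.2] at h
  exact (ENNReal.ofReal_le_ofReal_iff (integral_llr_nonneg hν h_intg)).1 h

/-- On a set charged by `μ` but not by `ν`, the log-likelihood of a mixture differs from the one
of `μ` by the log-weight. -/
lemma llr_mixture_ae [IsProbabilityMeasure μ] [IsProbabilityMeasure ν] [IsProbabilityMeasure π]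
    (hμ : μ ≪ π) {A : Set E} (hA : MeasurableSet A) (hμA : μ Aᶜ = 0)
    (hνA : ν A = 0) {c d : ℝ} (hc : 0 < c) :
    (fun z => llr (ENNReal.ofReal c • μ + ENNReal.ofReal d • ν) π z) =ᵐ[μ]
      fun z => Real.log c + llr μ π z := by
  have := μ.smul_finite (ENNReal.ofReal_ne_top (r := c))
  have := ν.smul_finite (ENNReal.ofReal_ne_top (r := d))
  have h1 := Measure.rnDeriv_add (ENNReal.ofReal c • μ) (ENNReal.ofReal d • ν) π
  have h2 := Measure.rnDeriv_smul_left_of_ne_top' μ π (ENNReal.ofReal_ne_top (r := c))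
  have h3 := Measure.rnDeriv_smul_left_of_ne_top' ν π (ENNReal.ofReal_ne_top (r := d))
  have h4 : ∀ᵐ z ∂π, z ∈ A → ν.rnDeriv π z = 0 := by
    have : ∫⁻ z in A, ν.rnDeriv π z ∂π = 0 :=
      le_antisymm ((Measure.setLIntegral_rnDeriv_le A).trans hνA.le) bot_le
    rw [lintegral_eq_zero_iff (Measure.measurable_rnDeriv _ _)] at this
    exact (ae_restrict_iff' hA).1 this
  have h5 : ∀ᵐ z ∂μ, z ∈ A := hμA
  filter_upwards [hμ h1, hμ h2, hμ h3, hμ h4, h5, Measure.rnDeriv_pos hμ,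
    hμ (Measure.rnDeriv_lt_top μ π)] with z h1 h2 h3 h4 h5 h6 h7
  simp only [llr]
  rw [h1, Pi.add_apply, h2, h3]
  simp only [Pi.smul_apply, h4 h5, smul_eq_mul, mul_zero, add_zero, ENNReal.toReal_mul,
    ENNReal.toReal_ofReal hc.le]
  exact Real.log_mul hc.ne' (ENNReal.toReal_pos h6.ne' h7.ne).ne'

lemma not_isMin_of_singular_mixture [IsProbabilityMeasure μ] [IsProbabilityMeasure ν]
    [IsProbabilityMeasure π] (hμ : μ ≪ π) (hμi : Integrable (llr μ π) μ) (hν : ν ≪ π)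
    (hνi : Integrable (llr ν π) ν) {A : Set E} (hA : MeasurableSet A) (hμA : μ A = 0)
    (hνA : ν Aᶜ = 0) :
    ∃ ε : ℝ, 0 < ε ∧ ε < 1 ∧
      KL (ENNReal.ofReal (1 - ε) • μ + ENNReal.ofReal ε • ν) π < KL μ π := by
  set a := ∫ z, llr μ π z ∂μ
  set b := ∫ z, llr ν π z ∂ν
  set ε := Real.exp (-(|a - b| + 1)) with hε
  have hε0 : 0 < ε := Real.exp_pos _
  have hε1 : ε < 1 := Real.exp_lt_one_iff.2 (by have := abs_nonneg (a - b); linarith)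
  have hlog : Real.log ε = -(|a - b| + 1) := Real.log_exp _
  refine ⟨ε, hε0, hε1, ?_⟩
  by_contra! hle
  have h1ε : 0 < 1 - ε := by linarith
  set η := ENNReal.ofReal (1 - ε) • μ + ENNReal.ofReal ε • ν with hη
  have : IsProbabilityMeasure η := ⟨by
    simp only [hη, Measure.coe_add, Measure.coe_smul, Pi.add_apply, Pi.smul_apply, measure_univ,
      smul_eq_mul, mul_one]
    rw [← ENNReal.ofReal_add h1ε.le hε0.le]
    simp⟩
  have hηπ : η ≪ π := (hμ.smul_left _).add_left (hν.smul_left _)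
  have e1 : (fun z => llr η π z) =ᵐ[μ] fun z => Real.log (1 - ε) + llr μ π z :=
    llr_mixture_ae hμ hA.compl (by rwa [compl_compl]) hνA h1ε
  have e2 : (fun z => llr η π z) =ᵐ[ν] fun z => Real.log ε + llr ν π z := by
    rw [hη, add_comm]
    exact llr_mixture_ae hν hA hνA hμA hε0
  have i1 : Integrable (llr η π) μ := ((integrable_const _).add hμi).congr e1.symm
  have i2 : Integrable (llr η π) ν := ((integrable_const _).add hνi).congr e2.symm
  have i1' := i1.smul_measure (c := ENNReal.ofReal (1 - ε)) ENNReal.ofReal_ne_top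
  have i2' := i2.smul_measure (c := ENNReal.ofReal ε) ENNReal.ofReal_ne_top
  have hηi : Integrable (llr η π) η := i1'.add_measure i2'
  obtain ⟨-, -, h⟩ := integral_llr_le_of_KL_le hηπ hηi hle
  rw [show ∫ z, llr η π z ∂η = (1 - ε) * (Real.log (1 - ε) + a) + ε * (Real.log ε + b) by
    conv_lhs => rw [hη]
    rw [integral_add_measure i1' i2', integral_smul_measure, integral_smul_measure,
      integral_congr_ae e1, integral_congr_ae e2, integral_add (integrable_const _) hμi,
      integral_add (integrable_const _) hνi, ENNReal.toReal_ofReal h1ε.le,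
      ENNReal.toReal_ofReal hε0.le]
    simp [a, b]] at h
  have h2 : Real.log (1 - ε) ≤ 0 := Real.log_nonpos h1ε.le (by linarith)
  have h3 : b - a ≤ |a - b| := by rw [abs_sub_comm]; exact le_abs_self _
  rw [hlog] at h
  nlinarith [mul_nonneg h1ε.le (neg_nonneg.2 h2)]

/-- First-order stationarity of the Kullback–Leibler divergence along bounded perturbations of
the density. -/
lemma integral_mul_llr_eq_zero [IsProbabilityMeasure μ] [IsProbabilityMeasure π] (hμ : μ ≪ π)
    (hμi : Integrable (llr μ π) μ) {h : E → ℝ} (hm : Measurable h) (hb : ∀ z, |h z| ≤ 1)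
    (h0 : ∫ z, h z ∂μ = 0)
    (hmin : ∀ ε : ℝ, |ε| ≤ 1 / 2 →
      KL μ π ≤ KL (μ.withDensity fun z => ENNReal.ofReal (1 + ε * h z)) π) :
    ∫ z, h z * llr μ π z ∂μ = 0 := by
  have hhi : Integrable h μ := Integrable.of_bound hm.aestronglyMeasurable 1 (.of_forall hb)
  have hhl : Integrable (fun z => h z * llr μ π z) μ :=
    hμi.bdd_mul hm.aestronglyMeasurable (.of_forall hb)
  set I := ∫ z, h z * llr μ π z ∂μ
  have key : ∀ ε : ℝ, |ε| ≤ 1 / 2 → 0 ≤ ε ^ 2 + ε * I := by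
    intro ε hε
    set w : E → ℝ := fun z => 1 + ε * h z with hw
    have hεh : ∀ z, |ε * h z| ≤ 1 / 2 := fun z => by
      rw [abs_mul]
      calc |ε| * |h z| ≤ 1 / 2 * 1 := mul_le_mul hε (hb z) (abs_nonneg _) (by norm_num)
        _ = 1 / 2 := by norm_num
    have hw0 : ∀ z, 1 / 2 ≤ w z := fun z => by
      have := (abs_le.1 (hεh z)).1
      simp only [hw]; linarith
    have hw1 : ∀ z, w z ≤ 3 / 2 := fun z => by
      have := (abs_le.1 (hεh z)).2
      simp only [hw]; linarith
    have hwpos : ∀ z, 0 < w z := fun z => lt_of_lt_of_le (by norm_num) (hw0 z)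
    have hwm : Measurable w := measurable_const.add (measurable_const.mul hm)
    have hwi : Integrable w μ := (integrable_const 1).add (hhi.const_mul ε)
    have hwint : ∫ z, w z ∂μ = 1 := by
      rw [integral_add (integrable_const 1) (hhi.const_mul ε), integral_const_mul, h0]; simp
    set η := μ.withDensity fun z => ENNReal.ofReal (w z) with hη
    have : IsProbabilityMeasure η := ⟨by
      rw [hη, withDensity_apply _ MeasurableSet.univ, Measure.restrict_univ,
        ← ofReal_integral_eq_lintegral_ofReal hwi (.of_forall fun z => (hwpos z).le), hwint]
      simp⟩
    have hημ : η ≪ μ := withDensity_absolutelyContinuous _ _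
    have e1 : llr η π =ᵐ[μ] fun z => Real.log (w z) + llr μ π z := by
      have h1 := Measure.rnDeriv_withDensity_left (μ := μ) (ν := π)
        (f := fun z => ENNReal.ofReal (w z)) hwm.ennreal_ofReal.aemeasurable
        (.of_forall fun z => ENNReal.ofReal_ne_top)
      filter_upwards [hμ h1, Measure.rnDeriv_pos hμ, hμ (Measure.rnDeriv_lt_top μ π)]
        with z h1 h2 h3
      simp only [llr]
      rw [h1, ENNReal.toReal_mul, ENNReal.toReal_ofReal (hwpos z).le]
      exact Real.log_mul (hwpos z).ne' (ENNReal.toReal_pos h2.ne' h3.ne).ne'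
    have hlogb : ∀ z, ‖Real.log (w z)‖ ≤ 1 := fun z => by
      rw [Real.norm_eq_abs, abs_le]
      constructor
      · have h1 := Real.one_sub_inv_le_log_of_pos (hwpos z)
        have h2 : (w z)⁻¹ ≤ 2 := by
          rw [inv_le_comm₀ (hwpos z) (by norm_num)]
          linarith [hw0 z]
        linarith
      · have := Real.log_le_sub_one_of_pos (hwpos z)
        linarith [hw1 z]
    have hli : Integrable (fun z => Real.log (w z)) μ :=
      Integrable.of_bound hwm.log.aestronglyMeasurable 1 (.of_forall hlogb)
    have hwb : ∀ z, ‖w z‖ ≤ 3 / 2 := fun z => by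
      rw [Real.norm_eq_abs, abs_of_pos (hwpos z)]; exact hw1 z
    have i2 : Integrable (fun z => w z * llr η π z) μ :=
      ((hli.add hμi).congr e1.symm).bdd_mul hwm.aestronglyMeasurable (.of_forall hwb)
    have hηi : Integrable (llr η π) η := by
      rw [hη, integrable_withDensity_iff_integrable_smul' hwm.ennreal_ofReal
        (.of_forall fun z => ENNReal.ofReal_lt_top)]
      refine i2.congr (.of_forall fun z => ?_)
      simp only [ENNReal.toReal_ofReal (hwpos z).le, smul_eq_mul, hη]
    obtain ⟨-, -, hle⟩ := integral_llr_le_of_KL_le (hημ.trans hμ) hηi (hmin ε hε)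
    have hcalc : ∫ z, llr η π z ∂η = ∫ z, w z * llr η π z ∂μ := by
      rw [hη, integral_withDensity_eq_integral_toReal_smul hwm.ennreal_ofReal
        (.of_forall fun z => ENNReal.ofReal_lt_top)]
      refine integral_congr_ae (.of_forall fun z => ?_)
      simp only [ENNReal.toReal_ofReal (hwpos z).le, smul_eq_mul]
    have i3 : Integrable (fun z => ε ^ 2 + ε * h z) μ := (integrable_const _).add (hhi.const_mul ε)
    have i4 : Integrable (fun z => llr μ π z + ε * (h z * llr μ π z)) μ :=
      hμi.add (hhl.const_mul ε)
    have hupper : ∫ z, w z * llr η π z ∂μ ≤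
        ∫ z, (ε ^ 2 + ε * h z + (llr μ π z + ε * (h z * llr μ π z))) ∂μ := by
      refine integral_mono_ae i2 (i3.add i4) ?_
      filter_upwards [e1] with z hz
      simp only [hz]
      have h1 := mul_le_mul_of_nonneg_left (Real.log_le_sub_one_of_pos (hwpos z)) (hwpos z).le
      have h2 : w z * (w z - 1) ≤ ε ^ 2 + ε * h z := by
        have : h z ^ 2 ≤ 1 := (sq_le_one_iff_abs_le_one _).2 (hb z)
        simp only [hw]
        nlinarith [mul_le_mul_of_nonneg_left this (sq_nonneg ε)]
      have h3 : w z * llr μ π z = llr μ π z + ε * (h z * llr μ π z) := by simp only [hw]; ring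
      linarith
    rw [integral_add i3 i4,
      integral_add (integrable_const _) (hhi.const_mul ε), integral_add hμi (hhl.const_mul ε),
      integral_const_mul, integral_const_mul, h0] at hupper
    simp only [integral_const, probReal_univ, smul_eq_mul, one_mul, mul_zero, add_zero] at hupper
    have : ∫ z, h z * llr μ π z ∂μ = I := rfl
    linarith
  by_contra hI
  rcases lt_or_gt_of_ne hI with hI | hI
  · set ε := min (1 / 2) (-I / 2)
    have hε : 0 < ε := lt_min (by norm_num) (by linarith)
    have h1 : ε ≤ 1 / 2 := min_le_left _ _
    have h2 : ε ≤ -I / 2 := min_le_right _ _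
    have := key ε (by rwa [abs_of_pos hε])
    nlinarith
  · set ε := min (1 / 2) (I / 2)
    have hε : 0 < ε := lt_min (by norm_num) (by linarith)
    have h1 : ε ≤ 1 / 2 := min_le_left _ _
    have h2 : ε ≤ I / 2 := min_le_right _ _
    have := key (-ε) (by rwa [abs_neg, abs_of_pos hε])
    nlinarith

end KullbackLeibler

section Star

open Classical in
/-- Mixtures of star-structured laws with essentially disjoint root marginals are
star-structured. -/
lemma isStar_mixture {k : ℕ} {p₁ p₂ : Measure ℝ} [IsProbabilityMeasure p₁]
    [IsProbabilityMeasure p₂] {κ₁ κ₂ : Fin k → Kernel ℝ ℝ} [∀ j, IsMarkovKernel (κ₁ j)]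
    [∀ j, IsMarkovKernel (κ₂ j)] {A : Set ℝ} (hA : MeasurableSet A) (h₁ : p₁ A = 0)
    (h₂ : p₂ Aᶜ = 0) {ε : ℝ} (hε0 : 0 < ε) (hε1 : ε < 1) :
    IsStar (ENNReal.ofReal (1 - ε) • (p₁ ⊗ₘ piKernel κ₁) +
      ENNReal.ofReal ε • (p₂ ⊗ₘ piKernel κ₂)) := by
  set κ : Fin k → Kernel ℝ ℝ := fun j => Kernel.piecewise hA (κ₂ j) (κ₁ j) with hκ
  have hp1 := p₁.smul_finite (ENNReal.ofReal_ne_top (r := 1 - ε))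
  have hp2 := p₂.smul_finite (ENNReal.ofReal_ne_top (r := ε))
  have : IsProbabilityMeasure (ENNReal.ofReal (1 - ε) • p₁ + ENNReal.ofReal ε • p₂) := ⟨by
    simp only [Measure.coe_add, Measure.coe_smul, Pi.add_apply, Pi.smul_apply, measure_univ,
      smul_eq_mul, mul_one]
    rw [← ENNReal.ofReal_add (by linarith) hε0.le]
    simp⟩
  have e1 : p₁ ⊗ₘ piKernel κ₁ = p₁ ⊗ₘ piKernel κ := by
    refine Measure.compProd_congr ?_
    have : ∀ᵐ a ∂p₁, a ∉ A := measure_eq_zero_iff_ae_notMem.1 h₁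
    filter_upwards [this] with a ha
    simp only [piKernel_apply, hκ, Kernel.piecewise_apply, if_neg ha]
  have e2 : p₂ ⊗ₘ piKernel κ₂ = p₂ ⊗ₘ piKernel κ := by
    refine Measure.compProd_congr ?_
    have : ∀ᵐ a ∂p₂, a ∈ A := h₂
    filter_upwards [this] with a ha
    simp only [piKernel_apply, hκ, Kernel.piecewise_apply, if_pos ha]
  rw [e1, e2, ← Measure.compProd_smul_left, ← Measure.compProd_smul_left,
    ← Measure.compProd_add_left]
  exact isStar_compProd _ κ

/-- Reweighting one leaf kernel of a star-structured law gives a star-structured law. -/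
lemma isStar_withDensity {k : ℕ} {p : Measure ℝ} [IsProbabilityMeasure p]
    {κ : Fin k → Kernel ℝ ℝ} [∀ j, IsMarkovKernel (κ j)] (i : Fin k) {h : ℝ × ℝ → ℝ}
    (hm : Measurable h) (hb : ∀ z, |h z| ≤ 1) (h0 : ∀ a, ∫ t, h (a, t) ∂κ i a = 0) {ε : ℝ}
    (hε : |ε| ≤ 1 / 2) :
    IsStar ((p ⊗ₘ piKernel κ).withDensity fun z => ENNReal.ofReal (1 + ε * h (z.1, z.2 i))) := by
  have hw0 : ∀ z, 0 ≤ 1 + ε * h z := fun z => by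
    have : |ε * h z| ≤ 1 := by
      rw [abs_mul]
      calc |ε| * |h z| ≤ 1 / 2 * 1 := mul_le_mul hε (hb z) (abs_nonneg _) (by norm_num)
        _ ≤ 1 := by norm_num
    linarith [(abs_le.1 this).1]
  have hhi : ∀ a, Integrable (fun t => h (a, t)) (κ i a) := fun a =>
    Integrable.of_bound (hm.comp measurable_prodMk_left).aestronglyMeasurable 1
      (.of_forall fun t => hb _)
  have hwi : ∀ a, Integrable (fun t => 1 + ε * h (a, t)) (κ i a) := fun a =>
    (integrable_const 1).add ((hhi a).const_mul ε)
  have hwm : Measurable (Function.uncurry fun a t => ENNReal.ofReal (1 + ε * h (a, t))) :=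
    (measurable_const.add (measurable_const.mul hm)).ennreal_ofReal
  set κi : Kernel ℝ ℝ := (κ i).withDensity fun a t => ENNReal.ofReal (1 + ε * h (a, t))
  have hκi : IsMarkovKernel κi := ⟨fun a => ⟨by
    rw [Kernel.withDensity_apply _ hwm, withDensity_apply _ MeasurableSet.univ,
      Measure.restrict_univ,
      ← ofReal_integral_eq_lintegral_ofReal (hwi a) (.of_forall fun t => hw0 _),
      integral_add (integrable_const 1) ((hhi a).const_mul ε), integral_const_mul, h0]
    simp⟩⟩
  set κ' : Fin k → Kernel ℝ ℝ := Function.update κ i κi with hκ'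
  have hM : ∀ j, IsMarkovKernel (κ' j) := fun j => by
    by_cases hj : j = i
    · subst hj; rw [hκ', Function.update_self]; exact hκi
    · rw [hκ', Function.update_of_ne hj]; infer_instance
  have hvm : Measurable (Function.uncurry fun (a : ℝ) (x : Fin k → ℝ) =>
      ENNReal.ofReal (1 + ε * h (a, x i))) := by
    refine (measurable_const.add (measurable_const.mul (hm.comp ?_))).ennreal_ofReal
    exact measurable_fst.prodMk ((measurable_pi_apply i).comp measurable_snd)
  have hK : piKernel κ' =
      (piKernel κ).withDensity fun a x => ENNReal.ofReal (1 + ε * h (a, x i)) := by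
    ext1 a
    rw [Kernel.withDensity_apply _ hvm, piKernel_apply, piKernel_apply]
    have h1 := pi_withDensity_ofReal (fun j => κ j a)
      (fun j t => if j = i then 1 + ε * h (a, t) else 1)
      (fun j t => by split_ifs <;> [exact hw0 _; exact zero_le_one])
      (fun j => by
        by_cases hj : j = i
        · subst hj; simpa using hwi a
        · simpa only [if_neg hj] using integrable_const 1)
    have h2 : (fun j => κ' j a) = fun j => (κ j a).withDensity fun t =>
        ENNReal.ofReal (if j = i then 1 + ε * h (a, t) else 1) := by
      funext j
      by_cases hj : j = i
      · subst hj
        rw [hκ', Function.update_self, Kernel.withDensity_apply _ hwm]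
        simp
      · rw [hκ', Function.update_of_ne hj]
        simp [hj]
    rw [h2, h1]
    simp
  have hMK : IsMarkovKernel ((piKernel κ).withDensity fun a x =>
      ENNReal.ofReal (1 + ε * h (a, x i))) := hK ▸ inferInstance
  have h3 := Measure.compProd_withDensity (μ := p) (κ := piKernel κ) hvm
  rw [← h3, ← hK]
  exact isStar_compProd p κ'

lemma integrable_integral_compProd {p : Measure ℝ} [SFinite p] {Ω : Type*} [MeasurableSpace Ω]
    {K : Kernel ℝ Ω} [IsSFiniteKernel K] {f : ℝ × Ω → ℝ} (hf : StronglyMeasurable f)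
    (hi : Integrable f (p ⊗ₘ K)) : Integrable (fun a => ∫ x, f (a, x) ∂K a) p :=
  ((Measure.integrable_compProd_iff hf.aestronglyMeasurable).1 hi).2.mono'
    hf.integral_kernel_prod_right'.aestronglyMeasurable
    (.of_forall fun _ => norm_integral_le_integral_norm _)

/-- If `F` is orthogonal to all bounded functions of the root and the `i`-th leaf which are
conditionally centered, then its conditional expectation given the root and the `i`-th leaf
depends on the root only. -/
lemma ae_integral_update_eq {k : ℕ} {p : Measure ℝ} [IsProbabilityMeasure p]
    {κ : Fin k → Kernel ℝ ℝ} [∀ j, IsMarkovKernel (κ j)] (i : Fin k)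
    {F : ℝ × (Fin k → ℝ) → ℝ} (hF : Measurable F) (hFi : Integrable F (p ⊗ₘ piKernel κ))
    (horth : ∀ h : ℝ × ℝ → ℝ, Measurable h → (∀ z, |h z| ≤ 1) →
      (∀ a, ∫ t, h (a, t) ∂κ i a = 0) →
      ∫ z, h (z.1, z.2 i) * F z ∂(p ⊗ₘ piKernel κ) = 0) :
    ∀ᵐ a ∂p, ∀ᵐ t ∂κ i a, ∫ x, F (a, Function.update x i t) ∂(Measure.pi fun j => κ j a) =
      ∫ x, F (a, x) ∂(Measure.pi fun j => κ j a) := by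
  set G : ℝ × ℝ → ℝ := fun y => ∫ x, F (y.1, Function.update x i y.2) ∂(piKernel κ y.1) with hG
  set m : ℝ → ℝ := fun a => ∫ x, F (a, x) ∂(piKernel κ a) with hm
  have hmm : Measurable m := hF.stronglyMeasurable.integral_kernel_prod_right'.measurable
  have hGm : Measurable G := by
    have h1 : Measurable fun y : (ℝ × ℝ) × (Fin k → ℝ) =>
        F (y.1.1, Function.update y.2 i y.1.2) := by
      refine hF.comp ((measurable_fst.comp measurable_fst).prodMk ?_)
      refine measurable_pi_lambda _ fun j => ?_
      by_cases hj : j = i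
      · subst hj; simp only [Function.update_self]
        exact measurable_snd.comp measurable_fst
      · simp only [Function.update_of_ne hj]
        exact (measurable_pi_apply j).comp measurable_snd
    exact (h1.stronglyMeasurable.integral_kernel_prod_right'
      (κ := (piKernel κ).comap Prod.fst measurable_fst)).measurable
  set s : Set (ℝ × ℝ) := {y | m y.1 < G y} with hs
  have hsm : MeasurableSet s := measurableSet_lt (hmm.comp measurable_fst) hGm
  set h : ℝ × ℝ → ℝ := fun y => s.indicator 1 y - (κ i y.1).real (Prod.mk y.1 ⁻¹' s) with hh
  have hhm : Measurable h := by
    refine (measurable_one.indicator hsm).sub ?_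
    exact ((Kernel.measurable_kernel_prodMk_left (κ := κ i) hsm).ennreal_toReal).comp measurable_fst
  have hhb : ∀ z, |h z| ≤ 1 := fun z => by
    have h1 : (0 : ℝ) ≤ (κ i z.1).real (Prod.mk z.1 ⁻¹' s) := measureReal_nonneg
    have h2 : (κ i z.1).real (Prod.mk z.1 ⁻¹' s) ≤ 1 := measureReal_le_one
    simp only [hh]
    by_cases hz : z ∈ s
    · rw [Set.indicator_of_mem hz, Pi.one_apply, abs_le]; constructor <;> linarith
    · rw [Set.indicator_of_notMem hz, abs_le]; constructor <;> linarith
  have hind : ∀ a, (fun t => s.indicator (1 : ℝ × ℝ → ℝ) (a, t)) =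
      (Prod.mk a ⁻¹' s).indicator 1 := fun a => by
    rfl
  have hsma : ∀ a, MeasurableSet (Prod.mk a ⁻¹' s) := fun a => measurable_prodMk_left hsm
  have hh0 : ∀ a, ∫ t, h (a, t) ∂κ i a = 0 := fun a => by
    have h1 : Integrable (fun t => s.indicator (1 : ℝ × ℝ → ℝ) (a, t)) (κ i a) := by
      rw [hind]; exact (integrable_const (1 : ℝ)).indicator (hsma a)
    simp only [hh]
    rw [integral_sub h1 (integrable_const _), hind, integral_indicator_one (hsma a)]
    simp
  have horth' := horth h hhm hhb hh0
  have hhim : Measurable fun z : ℝ × (Fin k → ℝ) => h (z.1, z.2 i) :=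
    hhm.comp (measurable_fst.prodMk ((measurable_pi_apply i).comp measurable_snd))
  have hhFi : Integrable (fun z : ℝ × (Fin k → ℝ) => h (z.1, z.2 i) * F z) (p ⊗ₘ piKernel κ) :=
    hFi.bdd_mul hhim.aestronglyMeasurable (.of_forall fun z => hhb _)
  have hsec := ((Measure.integrable_compProd_iff hF.aestronglyMeasurable).1 hFi).1
  have hGint : ∀ᵐ a ∂p, Integrable (fun t => G (a, t)) (κ i a) ∧
      ∫ t, G (a, t) ∂κ i a = m a := by
    filter_upwards [hsec] with a ha
    exact ⟨integrable_integral_update (fun j => κ j a) i ha,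
      (integral_pi_eq_integral_update (fun j => κ j a) i ha).symm⟩
  have hpos : ∀ᵐ a ∂p, Integrable (fun t => s.indicator (1 : ℝ × ℝ → ℝ) (a, t) * (G (a, t) - m a))
        (κ i a) ∧
      ∫ x, h (a, x i) * F (a, x) ∂piKernel κ a =
      ∫ t, s.indicator (1 : ℝ × ℝ → ℝ) (a, t) * (G (a, t) - m a) ∂κ i a := by
    have hsec' := ((Measure.integrable_compProd_iff
      (hhim.mul hF).aestronglyMeasurable).1 hhFi).1
    filter_upwards [hsec, hsec', hGint] with a ha ha' hg
    have i1 : Integrable (fun t => G (a, t) - m a) (κ i a) := hg.1.sub (integrable_const _)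
    have i2 : Integrable (fun t => s.indicator (1 : ℝ × ℝ → ℝ) (a, t) * (G (a, t) - m a))
        (κ i a) :=
      i1.bdd_mul (c := 1) (by
        rw [hind]; exact (measurable_one.indicator (hsma a)).aestronglyMeasurable)
        (.of_forall fun t => by
          by_cases hz : (a, t) ∈ s
          · rw [Set.indicator_of_mem hz]; simp
          · rw [Set.indicator_of_notMem hz]; simp)
    refine ⟨i2, ?_⟩
    have i3 : Integrable (fun t => h (a, t) * m a) (κ i a) :=
      (Integrable.of_bound (hhm.comp measurable_prodMk_left).aestronglyMeasurable 1
        (.of_forall fun t => hhb (a, t))).mul_const _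
    have i4 : Integrable (fun t => h (a, t) * (G (a, t) - m a)) (κ i a) :=
      i1.bdd_mul (hhm.comp measurable_prodMk_left).aestronglyMeasurable
        (.of_forall fun t => hhb (a, t))
    have e0 : ∫ x, h (a, x i) * F (a, x) ∂(Measure.pi fun j => κ j a) =
        ∫ t, ∫ x, h (a, Function.update x i t i) * F (a, Function.update x i t)
          ∂(Measure.pi fun j => κ j a) ∂κ i a :=
      integral_pi_eq_integral_update (fun j => κ j a) i ha'
    rw [piKernel_apply]
    refine e0.trans ?_
    have e1 : ∀ t, ∫ x, h (a, Function.update x i t i) * F (a, Function.update x i t)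
        ∂(Measure.pi fun j => κ j a) = h (a, t) * (G (a, t) - m a) + h (a, t) * m a := fun t => by
      simp only [Function.update_self]
      rw [integral_const_mul]
      simp only [hG, piKernel_apply]
      ring
    rw [integral_congr_ae (.of_forall e1), integral_add i4 i3, integral_mul_const, hh0, zero_mul,
      add_zero]
    have e2 : ∀ t, h (a, t) * (G (a, t) - m a) =
        s.indicator (1 : ℝ × ℝ → ℝ) (a, t) * (G (a, t) - m a) -
          (κ i a).real (Prod.mk a ⁻¹' s) * (G (a, t) - m a) := fun t => by
      simp only [hh]; ring
    rw [integral_congr_ae (.of_forall e2), integral_sub i2 (i1.const_mul _), integral_const_mul,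
      integral_sub hg.1 (integrable_const _), hg.2]
    simp
  have hnn : ∀ a t, 0 ≤ s.indicator (1 : ℝ × ℝ → ℝ) (a, t) * (G (a, t) - m a) := fun a t => by
    by_cases hz : (a, t) ∈ s
    · rw [Set.indicator_of_mem hz, Pi.one_apply, one_mul]
      exact sub_nonneg.2 (le_of_lt hz)
    · rw [Set.indicator_of_notMem hz, zero_mul]
  have hzero : ∀ᵐ a ∂p, ∫ x, h (a, x i) * F (a, x) ∂piKernel κ a = 0 := by
    rw [Measure.integral_compProd hhFi] at horth'
    refine (integral_eq_zero_iff_of_nonneg_ae ?_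
      (integrable_integral_compProd (hhim.mul hF).stronglyMeasurable hhFi)).1 horth'
    filter_upwards [hpos] with a ha
    have := integral_nonneg_of_ae (μ := κ i a) (.of_forall (hnn a))
    rw [← ha.2] at this
    exact this
  filter_upwards [hpos, hzero, hGint] with a h1 h2 h3
  rw [h1.2] at h2
  have h4 := (integral_eq_zero_iff_of_nonneg_ae (.of_forall (hnn a)) h1.1).1 h2
  have h5 : ∀ᵐ t ∂κ i a, 0 ≤ m a - G (a, t) := by
    filter_upwards [h4] with t ht
    by_contra! hlt
    have hz : (a, t) ∈ s := by simp only [hs, Set.mem_ofPred_eq]; linarith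
    rw [Set.indicator_of_mem hz, Pi.one_apply, one_mul, Pi.zero_apply] at ht
    linarith
  have h6 : ∫ t, (m a - G (a, t)) ∂κ i a = 0 := by
    rw [integral_sub (integrable_const _) h3.1, h3.2]; simp
  have h7 := (integral_eq_zero_iff_of_nonneg_ae h5 ((integrable_const _).sub h3.1)).1 h6
  filter_upwards [h7] with t ht
  simp only [Pi.zero_apply] at ht
  change G (a, t) = m a
  linarith

end Star

section Gibbs

lemma gibbs_absolutelyContinuous {E : Type*} [MeasureSpace E] (V : E → ℝ) :
    gibbs V ≪ volume :=
  (withDensity_absolutelyContinuous _ _).smul_left _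

lemma exists_volume_eq_gibbs_withDensity {E : Type*} [MeasureSpace E] {V : E → ℝ}
    (hV : Measurable V) [IsProbabilityMeasure (gibbs V)] :
    ∃ c : ℝ, 0 < c ∧
      (volume : Measure E) = (gibbs V).withDensity fun z => ENNReal.ofReal (c * Real.exp (V z)) := by
  set ρ : Measure E := volume.withDensity fun z => ENNReal.ofReal (Real.exp (-V z)) with hρ
  have hg : gibbs V = (ρ Set.univ)⁻¹ • ρ := rfl
  have hne : gibbs V ≠ 0 := IsProbabilityMeasure.ne_zero _
  have h0 : ρ Set.univ ≠ 0 := fun h => hne (by rw [hg, Measure.measure_univ_eq_zero.1 h, smul_zero])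
  have htop : ρ Set.univ ≠ ⊤ := fun h => hne (by rw [hg, h, ENNReal.inv_top, zero_smul])
  have hm1 : Measurable fun z => ENNReal.ofReal (Real.exp (-V z)) := hV.neg.exp.ennreal_ofReal
  have hm2 : Measurable fun z => ENNReal.ofReal ((ρ Set.univ).toReal * Real.exp (V z)) :=
    (measurable_const.mul hV.exp).ennreal_ofReal
  refine ⟨(ρ Set.univ).toReal, ENNReal.toReal_pos h0 htop, ?_⟩
  rw [hg, withDensity_smul_measure, hρ, ← withDensity_mul _ hm1 hm2, ← hρ,
    ← withDensity_smul _ (hm1.mul hm2)]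
  conv_lhs => rw [← withDensity_one (μ := (volume : Measure E))]
  congr 1
  funext z
  simp only [Pi.one_apply, Pi.smul_apply, Pi.mul_apply, smul_eq_mul]
  rw [ENNReal.ofReal_mul ENNReal.toReal_nonneg, ENNReal.ofReal_toReal htop, mul_left_comm
    (ENNReal.ofReal (Real.exp (-V z))), ← mul_assoc, ENNReal.inv_mul_cancel h0 htop, one_mul,
    ← ENNReal.ofReal_mul (Real.exp_pos _).le, ← Real.exp_add]
  simp

/-- Uniform distributions on boxes are star-structured with finite relative entropy. -/
lemma exists_isStar_on_Ioo {k : ℕ} {V : ℝ × (Fin k → ℝ) → ℝ} (hV : Continuous V)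
    [IsProbabilityMeasure (gibbs V)] {a b : ℝ} (hab : a < b) :
    ∃ (p : Measure ℝ) (κ : Fin k → Kernel ℝ ℝ) (_ : IsProbabilityMeasure p)
      (_ : ∀ j, IsMarkovKernel (κ j)), p (Set.Ioo a b)ᶜ = 0 ∧ p ⊗ₘ piKernel κ ≪ gibbs V ∧
      Integrable (llr (p ⊗ₘ piKernel κ) (gibbs V)) (p ⊗ₘ piKernel κ) := by
  obtain ⟨c, hc, hvol⟩ := exists_volume_eq_gibbs_withDensity hV.measurable
  set Q : Set (ℝ × (Fin k → ℝ)) := Set.Ioo a b ×ˢ Set.univ.pi fun _ => Set.Ioo 0 1 with hQ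
  have hQm : MeasurableSet Q := measurableSet_Ioo.prod (MeasurableSet.univ_pi fun _ => measurableSet_Ioo)
  have hl : 0 < b - a := sub_pos.2 hab
  set r : ℝ≥0∞ := ENNReal.ofReal (b - a)⁻¹ with hr
  set p : Measure ℝ := r • volume.restrict (Set.Ioo a b) with hp
  have hpp : IsProbabilityMeasure p := ⟨by
    simp only [hp, Measure.coe_smul, Pi.smul_apply, Measure.restrict_apply MeasurableSet.univ,
      Set.univ_inter, Real.volume_Ioo, smul_eq_mul, hr]
    rw [← ENNReal.ofReal_mul (inv_nonneg.2 hl.le), inv_mul_cancel₀ hl.ne', ENNReal.ofReal_one]⟩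
  have hu : IsProbabilityMeasure (volume.restrict (Set.Ioo (0 : ℝ) 1)) := ⟨by simp⟩
  set κ : Fin k → Kernel ℝ ℝ := fun _ => Kernel.const ℝ (volume.restrict (Set.Ioo (0 : ℝ) 1)) with hκ
  have hM : ∀ j, IsMarkovKernel (κ j) := fun j => by rw [hκ]; infer_instance
  have hK : piKernel κ = Kernel.const ℝ (Measure.pi fun _ => volume.restrict (Set.Ioo (0 : ℝ) 1)) := by
    ext1 x
    rw [piKernel_apply]
    simp [hκ]
  set g : ℝ × (Fin k → ℝ) → ℝ≥0∞ := fun z => ENNReal.ofReal (c * Real.exp (V z)) with hg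
  have hgm : Measurable g := (continuous_const.mul hV.rexp).measurable.ennreal_ofReal
  have hη : p ⊗ₘ piKernel κ = (gibbs V).withDensity (Q.indicator (r • g)) := by
    rw [withDensity_indicator hQm, withDensity_smul _ hgm, ← restrict_withDensity hQm]
    rw [← hvol, hK, Measure.compProd_const, hp, Measure.prod_smul_left, ← Measure.restrict_pi_pi,
      Measure.prod_restrict]
    rfl
  have hac : p ⊗ₘ piKernel κ ≪ gibbs V := by
    rw [hη]; exact withDensity_absolutelyContinuous _ _
  refine ⟨p, κ, hpp, hM, ?_, hac, ?_⟩
  · simp [hp, Measure.restrict_apply measurableSet_Ioo.compl]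
  · obtain ⟨B, hB⟩ := ((isCompact_Icc (a := a) (b := b)).prod
      (isCompact_univ_pi fun _ : Fin k => isCompact_Icc (a := (0 : ℝ)) (b := 1))
      ).exists_bound_of_continuousOn hV.continuousOn
    have h1 : (p ⊗ₘ piKernel κ).rnDeriv (gibbs V) =ᵐ[gibbs V] Q.indicator (r • g) := by
      rw [hη]
      exact Measure.rnDeriv_withDensity _ ((hgm.const_smul r).indicator hQm)
    have h2 : ∀ᵐ z ∂(p ⊗ₘ piKernel κ), z ∈ Q := by
      rw [hη, withDensity_indicator hQm]
      exact (withDensity_absolutelyContinuous _ _) (ae_restrict_mem hQm)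
    refine Integrable.of_bound (measurable_llr _ _).aestronglyMeasurable
      (|Real.log ((b - a)⁻¹ * c)| + B) ?_
    filter_upwards [hac h1, h2] with z h1 h2
    rw [llr, h1, Set.indicator_of_mem h2, Pi.smul_apply, smul_eq_mul, hr, hg,
      ← ENNReal.ofReal_mul (inv_nonneg.2 hl.le), ENNReal.toReal_ofReal (by positivity),
      ← mul_assoc, Real.log_mul (by positivity) (Real.exp_pos _).ne', Real.log_exp]
    refine (norm_add_le _ _).trans (add_le_add le_rfl (hB z ⟨Set.Ioo_subset_Icc_self h2.1, fun j _ =>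
      Set.Ioo_subset_Icc_self (h2.2 j (Set.mem_univ j))⟩))

/-- A star-structured minimizer has finite relative entropy and its root marginal charges every
interval. -/
lemma llr_integrable_of_isMin {k : ℕ} {V : ℝ × (Fin k → ℝ) → ℝ} (hV : Continuous V)
    [IsProbabilityMeasure (gibbs V)] {p : Measure ℝ} [IsProbabilityMeasure p]
    {κ : Fin k → Kernel ℝ ℝ} [∀ j, IsMarkovKernel (κ j)]
    (hmin : ∀ μ, IsStar μ → KL (p ⊗ₘ piKernel κ) (gibbs V) ≤ KL μ (gibbs V)) :
    p ⊗ₘ piKernel κ ≪ gibbs V ∧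
      Integrable (llr (p ⊗ₘ piKernel κ) (gibbs V)) (p ⊗ₘ piKernel κ) ∧
      ∀ a b, a < b → p (Set.Ioo a b) ≠ 0 := by
  have h1 : p ⊗ₘ piKernel κ ≪ gibbs V ∧
      Integrable (llr (p ⊗ₘ piKernel κ) (gibbs V)) (p ⊗ₘ piKernel κ) := by
    obtain ⟨p₂, κ₂, _, _, -, hac, hi⟩ := exists_isStar_on_Ioo hV (zero_lt_one' ℝ)
    obtain ⟨h1, h2, -⟩ := integral_llr_le_of_KL_le hac hi (hmin _ (isStar_compProd p₂ κ₂))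
    exact ⟨h1, h2⟩
  refine ⟨h1.1, h1.2, fun a b hab h0 => ?_⟩
  obtain ⟨p₂, κ₂, _, _, hp₂, hac, hi⟩ := exists_isStar_on_Ioo hV hab
  have hA : MeasurableSet (Prod.fst ⁻¹' Set.Ioo a b : Set (ℝ × (Fin k → ℝ))) :=
    measurable_fst measurableSet_Ioo
  obtain ⟨ε, hε0, hε1, hlt⟩ := not_isMin_of_singular_mixture h1.1 h1.2 hac hi hA
    (by rw [← Measure.fst_apply measurableSet_Ioo, Measure.fst_compProd, h0])
    (by rw [← Set.preimage_compl, ← Measure.fst_apply measurableSet_Ioo.compl,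
      Measure.fst_compProd, hp₂])
  exact hlt.not_ge (hmin _ (isStar_mixture measurableSet_Ioo h0 hp₂ hε0 hε1))

/-- The log-likelihood ratio of a star-structured law with leaf densities. -/
lemma llr_star_ae_eq {k : ℕ} {V : ℝ × (Fin k → ℝ) → ℝ} (hV : Measurable V)
    [IsProbabilityMeasure (gibbs V)] {p : Measure ℝ} [IsProbabilityMeasure p]
    {κ : Fin k → Kernel ℝ ℝ} [∀ j, IsMarkovKernel (κ j)] {q : Fin k → ℝ → ℝ → ℝ}
    (hq : ∀ j, Measurable fun y : ℝ × ℝ => q j y.1 y.2)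
    (hκ : ∀ j a, κ j a = volume.withDensity fun t => ENNReal.ofReal (q j a t))
    (hac : p ⊗ₘ piKernel κ ≪ gibbs V) :
    ∃ C : ℝ → ℝ, ∀ᵐ a ∂p, ∀ᵐ x ∂(Measure.pi fun j => κ j a),
      llr (p ⊗ₘ piKernel κ) (gibbs V) (a, x) =
        C a + ∑ j, Real.log (q j a (x j)) + V (a, x) := by
  obtain ⟨c, hc, hvol⟩ := exists_volume_eq_gibbs_withDensity hV
  have hpvol : p ≪ volume := by
    refine Measure.AbsolutelyContinuous.mk fun s hs h0 => ?_
    have h1 : (volume : Measure (ℝ × (Fin k → ℝ))) (Prod.fst ⁻¹' s) = 0 := by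
      rw [← Set.prod_univ, Measure.volume_eq_prod, Measure.prod_prod, h0, zero_mul]
    have h2 := hac (gibbs_absolutelyContinuous V h1)
    rwa [← Measure.fst_apply hs, Measure.fst_compProd] at h2
  set d : ℝ → ℝ≥0∞ := p.rnDeriv volume with hd
  have hdm : Measurable d := Measure.measurable_rnDeriv _ _
  set r : ℝ × (Fin k → ℝ) → ℝ := fun z => ∏ j, max (q j z.1 (z.2 j)) 0 with hr
  have hrm : Measurable r := Finset.measurable_prod _ fun j _ => ((hq j).comp
    (measurable_fst.prodMk ((measurable_pi_apply j).comp measurable_snd))).max measurable_const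
  have hrm' : Measurable (Function.uncurry fun (a : ℝ) (x : Fin k → ℝ) => ENNReal.ofReal (r (a, x))) :=
    hrm.ennreal_ofReal
  have hmax : ∀ j a, κ j a = volume.withDensity fun t => ENNReal.ofReal (max (q j a t) 0) :=
    fun j a => by
      rw [hκ]
      congr 1
      funext t
      rcases le_total (q j a t) 0 with h | h
      · rw [max_eq_right h, ENNReal.ofReal_of_nonpos h, ENNReal.ofReal_zero]
      · rw [max_eq_left h]
  have hK : piKernel κ = (Kernel.const ℝ (volume : Measure (Fin k → ℝ))).withDensity
      fun a x => ENNReal.ofReal (r (a, x)) := by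
    ext1 a
    rw [Kernel.withDensity_apply _ hrm', piKernel_apply, Kernel.const_apply]
    have h1 := pi_withDensity_ofReal (fun _ : Fin k => (volume : Measure ℝ))
      (fun j t => max (q j a t) 0) (fun j t => le_max_right _ _) (fun j => by
        have hm : Measurable fun t => max (q j a t) 0 :=
          ((hq j).comp measurable_prodMk_left).max measurable_const
        refine ⟨hm.aestronglyMeasurable, ?_⟩
        rw [hasFiniteIntegral_iff_ofReal (f := fun t => max (q j a t) 0) (.of_forall fun t => le_max_right _ _),
          ← setLIntegral_univ, ← withDensity_apply _ MeasurableSet.univ, ← hmax]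
        exact measure_lt_top _ _)
    simp only [← hmax] at h1
    exact h1
  have hMK : IsMarkovKernel ((Kernel.const ℝ (volume : Measure (Fin k → ℝ))).withDensity
      fun a x => ENNReal.ofReal (r (a, x))) := hK ▸ inferInstance
  set g : ℝ × (Fin k → ℝ) → ℝ≥0∞ := fun z => ENNReal.ofReal (c * Real.exp (V z)) with hg
  have hgm : Measurable g := (measurable_const.mul hV.exp).ennreal_ofReal
  have hdf : Measurable fun z : ℝ × (Fin k → ℝ) => d z.1 := hdm.comp measurable_fst
  have hμ : p ⊗ₘ piKernel κ =
      (gibbs V).withDensity (g * (fun z => d z.1) * fun z => ENNReal.ofReal (r z)) := by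
    rw [withDensity_mul _ (hgm.mul hdf) hrm.ennreal_ofReal, withDensity_mul _ hgm hdf, ← hvol,
      hK, Measure.compProd_withDensity hrm', Measure.compProd_const, Measure.volume_eq_prod,
      ← prod_withDensity_left hdm, Measure.withDensity_rnDeriv_eq _ _ hpvol]
  have hrn : (p ⊗ₘ piKernel κ).rnDeriv (gibbs V) =ᵐ[gibbs V]
      g * (fun z => d z.1) * fun z => ENNReal.ofReal (r z) := by
    conv_lhs => rw [hμ]
    exact Measure.rnDeriv_withDensity _ ((hgm.mul hdf).mul hrm.ennreal_ofReal)
  refine ⟨fun a => Real.log c + Real.log (d a).toReal, ?_⟩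
  have hall : ∀ᵐ z ∂(p ⊗ₘ piKernel κ), llr (p ⊗ₘ piKernel κ) (gibbs V) z =
      Real.log c + Real.log (d z.1).toReal + ∑ j, Real.log (q j z.1 (z.2 j)) + V z := by
    filter_upwards [hac hrn, Measure.rnDeriv_pos hac,
      hac (Measure.rnDeriv_lt_top (p ⊗ₘ piKernel κ) (gibbs V))] with z h1 h2 h3
    rw [h1] at h2 h3
    simp only [Pi.mul_apply] at h2 h3
    have hr0 : 0 < r z := by
      by_contra! h
      rw [ENNReal.ofReal_of_nonpos h, mul_zero] at h2
      exact lt_irrefl _ h2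
    have hd0 : d z.1 ≠ 0 := fun h => by
      rw [h, mul_zero, zero_mul] at h2
      exact lt_irrefl _ h2
    have hg0 : g z ≠ 0 := by simp only [hg]; positivity
    have hdt : d z.1 ≠ ⊤ := fun h => by
      rw [h, ENNReal.mul_top hg0, ENNReal.top_mul (by positivity)] at h3
      exact lt_irrefl _ h3
    have hq0 : ∀ j, max (q j z.1 (z.2 j)) 0 ≠ 0 := fun j =>
      Finset.prod_ne_zero_iff.1 hr0.ne' j (Finset.mem_univ j)
    have hqm : ∀ j, max (q j z.1 (z.2 j)) 0 = q j z.1 (z.2 j) := fun j => by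
      refine max_eq_left (le_of_not_ge fun h => hq0 j (max_eq_right h))
    rw [llr, h1]
    simp only [Pi.mul_apply, ENNReal.toReal_mul, ENNReal.toReal_ofReal hr0.le, hg]
    rw [ENNReal.toReal_ofReal (by positivity), Real.log_mul (mul_ne_zero (by positivity)
      (ENNReal.toReal_ne_zero.2 ⟨hd0, hdt⟩)) hr0.ne', Real.log_mul (by positivity)
      (ENNReal.toReal_ne_zero.2 ⟨hd0, hdt⟩), Real.log_mul hc.ne' (Real.exp_pos _).ne', Real.log_exp,
      hr, Real.log_prod fun j _ => hq0 j]
    simp only [hqm]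
    ring
  exact Measure.ae_ae_of_ae_compProd hall

end Gibbs

section Hessian

lemma abs_sub_le_of_abs_hasDerivAt_le {f f' : ℝ → ℝ} {C : ℝ} (hf : ∀ t, HasDerivAt f (f' t) t)
    (hC : ∀ t, |f' t| ≤ C) (s t : ℝ) : |f t - f s| ≤ C * |t - s| :=
  convex_univ.norm_image_sub_le_of_norm_hasDerivWithin_le (fun x _ => (hf x).hasDerivWithinAt)
    (fun x _ => hC x) (Set.mem_univ s) (Set.mem_univ t)

lemma mul_sub_le_sub_of_le_hasDerivAt {f f' : ℝ → ℝ} {c : ℝ} (hf : ∀ t, HasDerivAt f (f' t) t)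
    (hc : ∀ t, c ≤ f' t) {s t : ℝ} (hst : s ≤ t) : c * (t - s) ≤ f t - f s :=
  mul_sub_le_image_sub_of_le_deriv (fun x => (hf x).differentiableAt)
    (fun x => by rw [(hf x).deriv]; exact hc x) hst

variable {k : ℕ} {V : ℝ × (Fin k → ℝ) → ℝ}

lemma hasDerivAt_comp_update {f : ℝ × (Fin k → ℝ) → ℝ} (hf : Differentiable ℝ f) (a : ℝ)
    (x : Fin k → ℝ) (i : Fin k) (t : ℝ) :
    HasDerivAt (fun u => f (a, Function.update x i u))
      (fderiv ℝ f (a, Function.update x i t) (eL i)) t :=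
  (hf _).hasFDerivAt.comp_hasDerivAt t ((hasDerivAt_const t a).prodMk (hasDerivAt_update x i t))

lemma contDiff_fderiv_apply (hV : ContDiff ℝ 2 V) (u : ℝ × (Fin k → ℝ)) :
    ContDiff ℝ 1 fun z => fderiv ℝ V z u :=
  (hV.fderiv_right (m := 1) (by norm_num)).clm_apply contDiff_const

lemma hess_comm (hV : ContDiff ℝ 2 V) (z u v : ℝ × (Fin k → ℝ)) :
    hess V z u v = hess V z v u := by
  have hd : DifferentiableAt ℝ (fderiv ℝ V) z :=
    (hV.fderiv_right (m := 1) (by norm_num)).differentiable (by norm_num) z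
  have h : ∀ u v, hess V z u v = fderiv ℝ (fderiv ℝ V) z v u := fun u v => by
    rw [hess, fderiv_clm_apply hd (differentiableAt_const _)]
    simp
  rw [h, h]
  exact (hV.contDiffAt.isSymmSndFDerivAt (by simp)) v u

lemma le_sub_fderiv_leaf (hV : ContDiff ℝ 2 V) {ℓ : ℝ}
    (hP1 : ∀ z, ∀ b : Fin k → ℝ, ℓ * ∑ i, b i ^ 2 ≤ hess V z ((0 : ℝ), b) ((0 : ℝ), b))
    (a : ℝ) (i : Fin k) (x : Fin k → ℝ) {s t : ℝ} (hst : s ≤ t) :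
    ℓ * (t - s) ≤ fderiv ℝ V (a, Function.update x i t) (eL i) -
      fderiv ℝ V (a, Function.update x i s) (eL i) := by
  refine mul_sub_le_sub_of_le_hasDerivAt (fun u => hasDerivAt_comp_update
    ((contDiff_fderiv_apply hV (eL i)).differentiable (by norm_num)) a x i u) (fun u => ?_) hst
  have h := hP1 (a, Function.update x i u) (Pi.single i 1)
  simp only [Pi.single_apply, ite_pow, one_pow, ne_eq, OfNat.ofNat_ne_zero, not_false_eq_true,
    zero_pow, Finset.sum_ite_eq', Finset.mem_univ, if_true, mul_one] at h
  exact h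

lemma abs_sub_fderiv_leaf_le (hV : ContDiff ℝ 2 V) {ℓ L : ℝ} (hℓ : 0 ≤ ℓ)
    (hP1 : ∀ z, ∀ b : Fin k → ℝ, ℓ * ∑ i, b i ^ 2 ≤ hess V z ((0 : ℝ), b) ((0 : ℝ), b))
    (hP2 : ∀ z, ∀ b : Fin k → ℝ, hess V z ((0 : ℝ), b) ((0 : ℝ), b) ≤ L * ∑ i, b i ^ 2)
    (a : ℝ) (i : Fin k) (x : Fin k → ℝ) (s t : ℝ) :
    |fderiv ℝ V (a, Function.update x i t) (eL i) -
      fderiv ℝ V (a, Function.update x i s) (eL i)| ≤ L * |t - s| := by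
  refine abs_sub_le_of_abs_hasDerivAt_le (fun u => hasDerivAt_comp_update
    ((contDiff_fderiv_apply hV (eL i)).differentiable (by norm_num)) a x i u) (fun u => ?_) s t
  have h1 := hP1 (a, Function.update x i u) (Pi.single i 1)
  have h2 := hP2 (a, Function.update x i u) (Pi.single i 1)
  simp only [Pi.single_apply, ite_pow, one_pow, ne_eq, OfNat.ofNat_ne_zero, not_false_eq_true,
    zero_pow, Finset.sum_ite_eq', Finset.mem_univ, if_true, mul_one] at h1 h2
  exact (abs_of_nonneg (hℓ.trans h1)).le.trans h2

lemma abs_sub_fderiv_root_le (hV : ContDiff ℝ 2 V) {M : ℝ} (i : Fin k)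
    (hM : ∀ z, |hess V z e0 (eL i)| ≤ M) (a b : ℝ) (x : Fin k → ℝ) :
    |fderiv ℝ V (a, x) (eL i) - fderiv ℝ V (b, x) (eL i)| ≤ M * |a - b| := by
  refine abs_sub_le_of_abs_hasDerivAt_le (f := fun c => fderiv ℝ V (c, x) (eL i))
    (f' := fun c => hess V (c, x) (eL i) e0) (fun c => ?_)
    (fun c => by rw [hess_comm hV]; exact hM _) b a
  exact ((contDiff_fderiv_apply hV (eL i)).differentiable (by norm_num) _).hasFDerivAt.comp_hasDerivAt
    c ((hasDerivAt_id c).prodMk (hasDerivAt_const c x))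

lemma abs_sub_fderiv_leaf_le_norm (hV : ContDiff ℝ 2 V) {M : ℝ} (i : Fin k)
    (hM : ∀ z, (∑ j : Fin k, if j = i then 0 else |hess V z (eL i) (eL j)|) ≤ M) (a : ℝ)
    (x y : Fin k → ℝ) (t : ℝ) :
    |fderiv ℝ V (a, Function.update x i t) (eL i) -
      fderiv ℝ V (a, Function.update y i t) (eL i)| ≤ M * ‖x - y‖ := by
  set d : Fin k → ℝ := Function.update x i t - Function.update y i t with hd
  have hdi : d i = 0 := by simp [hd]
  have hdj : ∀ j, |d j| ≤ ‖x - y‖ := fun j => by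
    by_cases hj : j = i
    · rw [hj, hdi, abs_zero]; exact norm_nonneg _
    · have : d j = (x - y) j := by simp [hd, hj]
      rw [this]
      exact norm_le_pi_norm (x - y) j
  have hdsum : ((0 : ℝ), d) = ∑ j, d j • (eL j : ℝ × (Fin k → ℝ)) := by
    refine Prod.ext ?_ ?_
    · simp [eL, Prod.fst_sum]
    · rw [Prod.snd_sum]
      funext j
      simp [eL, Finset.sum_apply, Pi.single_apply]
  have hder : ∀ s : ℝ, HasDerivAt
      (fun s : ℝ => fderiv ℝ V (a, Function.update y i t + s • d) (eL i))
      (hess V (a, Function.update y i t + s • d) (eL i) (0, d)) s := fun s => by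
    refine ((contDiff_fderiv_apply hV (eL i)).differentiable (by norm_num)
      _).hasFDerivAt.comp_hasDerivAt s ((hasDerivAt_const s a).prodMk ?_)
    simpa using ((hasDerivAt_id s).smul_const d).const_add (Function.update y i t)
  have hbd : ∀ s : ℝ, |hess V (a, Function.update y i t + s • d) (eL i) (0, d)| ≤
      M * ‖x - y‖ := fun s => by
    set z := (a, Function.update y i t + s • d)
    have h1 : hess V z (eL i) (0, d) = ∑ j, d j * hess V z (eL i) (eL j) := by
      rw [hess, hdsum, map_sum]
      simp [hess]
    rw [h1]
    refine (Finset.abs_sum_le_sum_abs _ _).trans ?_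
    refine le_trans ?_ (mul_le_mul_of_nonneg_right (hM z) (norm_nonneg _))
    rw [Finset.sum_mul]
    refine Finset.sum_le_sum fun j _ => ?_
    by_cases hj : j = i
    · subst hj; simp [hdi]
    · rw [if_neg hj, abs_mul, mul_comm]
      exact mul_le_mul_of_nonneg_left (hdj j) (abs_nonneg _)
  have h := abs_sub_le_of_abs_hasDerivAt_le hder hbd 0 1
  simpa [hd] using h

end Hessian

section Main

/-- For almost every value of the root, the leaf densities of a star-structured minimizer solve
the mean-field equations. -/
lemma ae_meanField_of_isMin {k : ℕ} {V : ℝ × (Fin k → ℝ) → ℝ} (hV : ContDiff ℝ 2 V) {ℓ L : ℝ}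
    (hℓ : 0 ≤ ℓ)
    (hP1 : ∀ z, ∀ b : Fin k → ℝ, ℓ * ∑ i, b i ^ 2 ≤ hess V z ((0 : ℝ), b) ((0 : ℝ), b))
    (hP2 : ∀ z, ∀ b : Fin k → ℝ, hess V z ((0 : ℝ), b) ((0 : ℝ), b) ≤ L * ∑ i, b i ^ 2)
    [IsProbabilityMeasure (gibbs V)] {p : Measure ℝ} [IsProbabilityMeasure p]
    {κ : Fin k → Kernel ℝ ℝ} [∀ j, IsMarkovKernel (κ j)] {q : Fin k → ℝ → ℝ → ℝ}
    (hq : ∀ j, Continuous fun y : ℝ × ℝ => q j y.1 y.2)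
    (hκ : ∀ j a, κ j a = volume.withDensity fun t => ENNReal.ofReal (q j a t))
    (hmin : ∀ μ, IsStar μ → KL (p ⊗ₘ piKernel κ) (gibbs V) ≤ KL μ (gibbs V)) :
    ∀ᵐ a ∂p, ∀ i, (∀ t, 0 < q i a t) ∧
      (∀ t, Integrable (fun x => fderiv ℝ V (a, Function.update x i t) (eL i))
        (Measure.pi fun j => κ j a)) ∧
      ∀ t, HasDerivAt (fun u => Real.log (q i a u))
        (-∫ x, fderiv ℝ V (a, Function.update x i t) (eL i) ∂(Measure.pi fun j => κ j a)) t := by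
  obtain ⟨hac, hi, -⟩ := llr_integrable_of_isMin hV.continuous hmin
  obtain ⟨C, hC⟩ := llr_star_ae_eq hV.continuous.measurable (fun j => (hq j).measurable) hκ hac
  have hsec := ((Measure.integrable_compProd_iff (measurable_llr _ _).aestronglyMeasurable).1 hi).1
  have hstat := ae_all_iff.2 fun i : Fin k => ae_integral_update_eq i
    (measurable_llr (p ⊗ₘ piKernel κ) (gibbs V)) hi fun h hm hb h0 => by
      have hhm : Measurable fun z : ℝ × (Fin k → ℝ) => h (z.1, z.2 i) :=
        hm.comp (measurable_fst.prodMk ((measurable_pi_apply i).comp measurable_snd))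
      refine integral_mul_llr_eq_zero hac hi hhm (fun z => hb _) ?_ fun ε hε =>
        hmin _ (isStar_withDensity i hm hb h0 hε)
      rw [Measure.integral_compProd (Integrable.of_bound hhm.aestronglyMeasurable 1
        (.of_forall fun z => hb _))]
      refine integral_eq_zero_of_ae (.of_forall fun a => ?_)
      have hev := measurePreserving_eval (fun j => κ j a) i
      have h1 : ∫ x, h (a, x i) ∂(Measure.pi fun j => κ j a) = ∫ t, h (a, t) ∂κ i a := by
        have hma : Measurable fun t => h (a, t) := hm.comp measurable_prodMk_left
        conv_rhs => rw [← hev.map_eq]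
        rw [integral_map hev.measurable.aemeasurable hma.aestronglyMeasurable]
      exact h1.trans (h0 a)
  filter_upwards [hC, hsec, hstat] with a h1 h2 h3 i
  exact meanField_score (v := fun x => V (a, x)) (w := fun x => fderiv ℝ V (a, x) (eL i))
    (hV.continuous.comp (Continuous.prodMk_right a))
    ((contDiff_fderiv_apply hV (eL i)).continuous.comp (Continuous.prodMk_right a))
    (fun x t => hasDerivAt_comp_update (hV.differentiable (by norm_num)) a x i t)
    (fun x s t => abs_sub_fderiv_leaf_le hV hℓ hP1 hP2 a i x s t)
    (q := fun j => q j a) (fun j => (hq j).comp (Continuous.prodMk_right a)) (fun j => hκ j a)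
    h2 h1 (h3 i)

/-- A likelihood-ratio bound that holds for a dense set of parameters forces positivity of the
densities and bounds the mixed derivative of their logarithm. -/
lemma abs_deriv_deriv_log_le {q : ℝ → ℝ → ℝ} (hq : ContDiff ℝ 2 fun y : ℝ × ℝ => q y.1 y.2)
    (hne : ∀ a, ∃ t, 0 < q a t) {s : Set ℝ} (hs : Dense s) (hpos : ∀ a ∈ s, ∀ t, 0 < q a t)
    {C : ℝ} (hC : 0 ≤ C)
    (hbd : ∀ a ∈ s, ∀ b ∈ s, ∀ t u, |(Real.log (q a t) - Real.log (q b t)) -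
      (Real.log (q a u) - Real.log (q b u))| ≤ C * |a - b| * |t - u|) (a t : ℝ) :
    |deriv (fun b => deriv (fun u => Real.log (q b u)) t) a| ≤ C := by
  have hqt : ∀ t, Continuous fun a => q a t := fun t =>
    hq.continuous.comp (Continuous.prodMk_left t)
  have hexp : ∀ t u (y : ℝ × ℝ),
      q y.1 t * q y.2 u ≤ q y.1 u * q y.2 t * Real.exp (C * |y.1 - y.2| * |t - u|) := by
    intro t u y
    have hcl : IsClosed {y : ℝ × ℝ | q y.1 t * q y.2 u ≤
        q y.1 u * q y.2 t * Real.exp (C * |y.1 - y.2| * |t - u|)} := by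
      have h1 := hqt t
      have h2 := hqt u
      refine isClosed_le ((h1.comp continuous_fst).mul (h2.comp continuous_snd))
        (((h2.comp continuous_fst).mul (h1.comp continuous_snd)).mul ?_)
      fun_prop
    have hsub : s ×ˢ s ⊆ {y : ℝ × ℝ | q y.1 t * q y.2 u ≤
        q y.1 u * q y.2 t * Real.exp (C * |y.1 - y.2| * |t - u|)} := by
      rintro ⟨a, b⟩ ⟨ha, hb⟩
      have h1 := hpos a ha t
      have h2 := hpos b hb u
      have h3 := hpos a ha u
      have h4 := hpos b hb t
      have h := (abs_le.1 (hbd a ha b hb t u)).2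
      change q a t * q b u ≤ q a u * q b t * Real.exp (C * |a - b| * |t - u|)
      rw [← Real.log_le_log_iff (by positivity) (by positivity), Real.log_mul h1.ne' h2.ne',
        Real.log_mul (by positivity) (Real.exp_pos _).ne', Real.log_mul h3.ne' h4.ne',
        Real.log_exp]
      linarith
    have := closure_minimal hsub hcl
    rw [(hs.prod hs).closure_eq] at this
    exact this (Set.mem_univ y)
  obtain ⟨b₀, hb₀⟩ := hs.nonempty
  have hnn : ∀ a t, 0 ≤ q a t := fun a t => by
    have hsub : s ⊆ {a | 0 ≤ q a t} := fun a ha => (hpos a ha t).le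
    have := closure_minimal hsub (isClosed_le continuous_const (hqt t))
    rw [hs.closure_eq] at this
    exact this (Set.mem_univ a)
  have hpos' : ∀ a t, 0 < q a t := fun a u => by
    refine (hnn a u).lt_of_ne' fun h0 => ?_
    obtain ⟨t, ht⟩ := hne a
    have := hexp t u (a, b₀)
    simp only [h0, zero_mul] at this
    exact this.not_gt (mul_pos ht (hpos b₀ hb₀ u))
  have hlog : ∀ a b t u, (Real.log (q a t) - Real.log (q b t)) -
      (Real.log (q a u) - Real.log (q b u)) ≤ C * |a - b| * |t - u| := fun a b t u => by
    have h1 := hpos' a t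
    have h2 := hpos' b u
    have h3 := hpos' a u
    have h4 := hpos' b t
    have h := hexp t u (a, b)
    simp only at h
    rw [← Real.log_le_log_iff (by positivity) (by positivity), Real.log_mul h1.ne' h2.ne',
        Real.log_mul (by positivity) (Real.exp_pos _).ne', Real.log_mul h3.ne' h4.ne',
        Real.log_exp] at h
    linarith
  have hdiff : ∀ a, DifferentiableAt ℝ (fun u => Real.log (q a u)) t := fun a => by
    refine DifferentiableAt.log ?_ (hpos' a t).ne'
    exact ((hq.differentiable (by norm_num)).comp
      ((differentiable_const a).prodMk differentiable_id)) t
  have hlip : ∀ b, |deriv (fun u => Real.log (q b u)) t - deriv (fun u => Real.log (q a u)) t| ≤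
      C * |b - a| := fun b => by
    rw [← deriv_fun_sub (hdiff b) (hdiff a), ← Real.norm_eq_abs]
    refine norm_deriv_le_of_lip' (by positivity) (.of_forall fun u => ?_)
    refine abs_le.2 ⟨?_, hlog b a u t⟩
    have := hlog b a t u
    rw [abs_sub_comm t u] at this
    rw [Real.norm_eq_abs]
    linarith
  rw [← Real.norm_eq_abs]
  exact norm_deriv_le_of_lip' hC (.of_forall fun b => hlip b)

end Main

/-- **Mixed-derivative bound for the SSVI minimizer** (d = k + 1 ≥ 2): under (R), (P1),
(P2) and (RD+), the mixed log-density derivatives of the conditional leaf densities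
satisfy `L := max_i sup |∂_{z₁}∂_{z_i} log q⋆_i(z_i ∣ z₁)| ≤ L̄`.  The `L∞` norms in
(RD+) and in `L̄` are expressed via arbitrary pointwise bounds `M₁, M₂` (equivalently,
the corresponding essential suprema). -/
theorem stmt16 {k : ℕ} (hk : 1 ≤ k)
    (V : ℝ × (Fin k → ℝ) → ℝ) (hV : ContDiff ℝ 2 V) (hgr : GrowthCond V)
    (ℓV LV ℓV' LV' : ℝ) (hℓV : 0 < ℓV) (hℓV' : 0 < ℓV')
    -- (R)
    (hR : ∀ z, hess V z e0 e0 ≤ LV' / 2)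
    -- (P1)
    (hP1 : ∀ z, ∀ b : Fin k → ℝ,
      ℓV * ∑ i, b i ^ 2 ≤ hess V z ((0:ℝ), b) ((0:ℝ), b))
    -- (P2)
    (hP2 : ∀ z, ∀ b : Fin k → ℝ,
      hess V z ((0:ℝ), b) ((0:ℝ), b) ≤ LV * ∑ i, b i ^ 2)
    -- (RD+)
    (hRDp : ∃ M₁ M₂ : ℝ,
      (∀ (i : Fin k) z, |hess V z e0 (eL i)| ≤ M₁) ∧
      (∀ (i : Fin k) z,
        (∑ j : Fin k, if j = i then 0 else |hess V z (eL i) (eL j)|) ≤ M₂) ∧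
      M₂ < ℓV ∧
      ∀ z, ℓV' ≤ hess V z e0 e0 - (k : ℝ) * M₁ ^ 2 / (ℓV - M₂))
    (π : Measure (ℝ × (Fin k → ℝ))) [IsProbabilityMeasure π] (hπ : π = gibbs V)
    -- π⋆ = p ⊗ ∏ⱼ κ j : the star-structured minimizer, with C² conditional densities
    (p : Measure ℝ) (κ : Fin k → Kernel ℝ ℝ)
    (hp : IsProbabilityMeasure p) (hκ : ∀ j, IsMarkovKernel (κ j))
    (hstar : IsStar (starMeasure p κ))
    (hmin : ∀ μ, IsStar μ → KL (starMeasure p κ) π ≤ KL μ π)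
    (qd : Fin k → ℝ → ℝ → ℝ)
    (hqd : ∀ i, ContDiff ℝ 2 fun pr : ℝ × ℝ => qd i pr.1 pr.2)
    (hqdens : ∀ i z₁, κ i z₁ = volume.withDensity fun t => ENNReal.ofReal (qd i z₁ t)) :
    -- conclusion: L ≤ L̄
    ∀ M₁ M₂ : ℝ,
      (∀ (i : Fin k) z, |hess V z e0 (eL i)| ≤ M₁) →
      (∀ (i : Fin k) z,
        (∑ j : Fin k, if j = i then 0 else |hess V z (eL i) (eL j)|) ≤ M₂) →
      M₂ < ℓV →
      ∀ (i : Fin k) (z₁ zi : ℝ),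
        |deriv (fun s => deriv (fun u => Real.log (qd i s u)) zi) z₁| ≤
          ℓV * M₁ / (ℓV - M₂) := by

  subst hπ
  intro M₁ M₂ hM₁ hM₂ hlt i z₁ zi
  have hM₁0 : 0 ≤ M₁ := (abs_nonneg _).trans (hM₁ i 0)
  have hM₂0 : 0 ≤ M₂ := (Finset.sum_nonneg fun j _ => by
    split_ifs
    · exact le_rfl
    · exact abs_nonneg _).trans (hM₂ i 0)
  rw [starMeasure_eq_compProd] at hmin
  obtain ⟨-, -, hfull⟩ := llr_integrable_of_isMin hV.continuous hmin
  have hae := ae_meanField_of_isMin hV hℓV.le hP1 hP2 (fun j => (hqd j).continuous) hqdens hmin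
  have hdense : Dense {a | ∀ i, (∀ t, 0 < qd i a t) ∧
      (∀ t, Integrable (fun x => fderiv ℝ V (a, Function.update x i t) (eL i))
        (Measure.pi fun j => κ j a)) ∧
      ∀ t, HasDerivAt (fun u => Real.log (qd i a u))
        (-∫ x, fderiv ℝ V (a, Function.update x i t) (eL i) ∂(Measure.pi fun j => κ j a)) t} := by
    refine dense_of_exists_between fun a b hab => ?_
    by_contra! h
    refine hfull a b hab (measure_mono_null (fun c hc => ?_) hae)
    exact fun hcs => h c hcs hc
  have hne : ∀ a, ∃ t, 0 < qd i a t := fun a => by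
    by_contra! h
    have h1 : κ i a = 0 := by
      rw [hqdens]
      simp [ENNReal.ofReal_of_nonpos (h _)]
    exact IsProbabilityMeasure.ne_zero (κ i a) h1
  refine abs_deriv_deriv_log_le (hqd i) hne hdense (fun a ha => (ha i).1)
    (div_nonneg (mul_nonneg hℓV.le hM₁0) (sub_pos.2 hlt).le) (fun a ha b hb t u => ?_) z₁ zi
  refine abs_sub_le_of_abs_hasDerivAt_le
    (f := fun t => Real.log (qd i a t) - Real.log (qd i b t))
    (fun t => ((ha i).2.2 t).sub ((hb i).2.2 t)) (fun t => ?_) u t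
  have h := abs_meanField_score_sub_le (w := fun j x => fderiv ℝ V (a, x) (eL j))
    (w' := fun j x => fderiv ℝ V (b, x) (eL j))
    (fun j => (hqd j).continuous.comp (Continuous.prodMk_right a))
    (fun j => (hqd j).continuous.comp (Continuous.prodMk_right b))
    (fun j => hqdens j a) (fun j => hqdens j b) (fun j => (ha j).1) (fun j => (hb j).1)
    (fun j => (contDiff_fderiv_apply hV (eL j)).continuous.comp (Continuous.prodMk_right b))
    (fun j => (ha j).2.1) (fun j => (hb j).2.1) (fun j => (ha j).2.2) (fun j => (hb j).2.2)
    hℓV hM₂0 hlt (fun j x s t hst => le_sub_fderiv_leaf hV hP1 a j x hst)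
    (fun j x s t hst => le_sub_fderiv_leaf hV hP1 b j x hst)
    (fun j x => abs_sub_fderiv_root_le hV j (hM₁ j) a b x)
    (fun j x y t => abs_sub_fderiv_leaf_le_norm hV j (hM₂ j) b x y t) i t
  rw [neg_sub_neg, abs_sub_comm, div_mul_eq_mul_div, mul_assoc]
  exact h
end

section
/- Let d ≥ 1 and let c₁, c₂, c₃ > 0. For i = 0, 1, let L_i := D_i + u_i e₁ᵀ ∈ ℝ^{d×d}, where D_i is a diagonal matrix with c₁ I ⪯ D_i ⪯ c₂ I, e₁ is the first standard basis vector, and u_i = (0, u_{i2}, …, u_{id})ᵀ ∈ ℝ^d has first coordinate zero and ‖u_i‖_∞ ≤ c₃. For each t ∈ [0,1], the matrix L_t := (1−t)L₀ + tL₁ is invertible and satisfies ‖L_t‖₂ ≤ c₂ + √(d−1) c₃ and ‖L_t^{−1}‖₂ ≤ (c₁ + √(d−1) c₃)/c₁². -/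
open Matrix

/-- The spectral (operator) norm `‖·‖₂` of a real square matrix. -/
noncomputable def spec {d : ℕ} (M : Matrix (Fin d) (Fin d) ℝ) : ℝ :=
  ‖LinearMap.toContinuousLinearMap (Matrix.toEuclideanLin M)‖

/-- The first standard basis vector `e₁` of `ℝ^d`. -/
def eFirst (d : ℕ) [NeZero d] : Fin d → ℝ := fun j => if j = 0 then 1 else 0

/-- `L = D + u e₁ᵀ`. -/
def Lmat {d : ℕ} [NeZero d] (D : Matrix (Fin d) (Fin d) ℝ) (u : Fin d → ℝ) :
    Matrix (Fin d) (Fin d) ℝ :=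
  D + Matrix.vecMulVec u (eFirst d)

theorem norm_toLp_le_of_zero {d : ℕ} [NeZero d] {u : Fin d → ℝ} {k : ℝ} (hk : 0 ≤ k)
    (hu0 : u 0 = 0) (hu : ∀ j, |u j| ≤ k) :
    ‖WithLp.toLp 2 u‖ ≤ √((d : ℝ) - 1) * k := by
  have hd : (1 : ℝ) ≤ d := by exact_mod_cast Nat.one_le_iff_ne_zero.mpr (NeZero.ne d)
  rw [EuclideanSpace.norm_eq]
  refine Real.sqrt_le_iff.mpr ⟨by positivity, ?_⟩
  rw [mul_pow, Real.sq_sqrt (by linarith), ← Finset.add_sum_erase _ _ (Finset.mem_univ (0 : Fin d))]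
  have h := Finset.sum_le_card_nsmul (Finset.univ.erase (0 : Fin d)) (fun j => ‖u j‖ ^ 2) (k ^ 2)
    fun j _ => pow_le_pow_left₀ (norm_nonneg _) (hu j) 2
  rw [Finset.card_erase_of_mem (Finset.mem_univ _), Finset.card_univ, Fintype.card_fin,
    nsmul_eq_mul, Nat.cast_sub (by exact_mod_cast hd), Nat.cast_one] at h
  simpa [hu0] using h

theorem norm_toLp_mul_le {d : ℕ} {a : Fin d → ℝ} {c : ℝ} (hc : 0 ≤ c) (ha : ∀ i, |a i| ≤ c)
    (x : EuclideanSpace ℝ (Fin d)) : ‖WithLp.toLp 2 (fun i => a i * x i)‖ ≤ c * ‖x‖ := by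
  rw [EuclideanSpace.norm_eq, EuclideanSpace.norm_eq]
  refine Real.sqrt_le_iff.mpr ⟨by positivity, ?_⟩
  rw [mul_pow, Real.sq_sqrt (by positivity), Finset.mul_sum]
  refine Finset.sum_le_sum fun i _ => ?_
  rw [norm_mul, mul_pow]
  exact mul_le_mul_of_nonneg_right (pow_le_pow_left₀ (norm_nonneg _) (ha i) 2) (by positivity)

theorem Lmat_diagonal_mulVec {d : ℕ} [NeZero d] (a u x : Fin d → ℝ) (i : Fin d) :
    (Lmat (diagonal a) u *ᵥ x) i = a i * x i + x 0 * u i := by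
  have h : eFirst d ⬝ᵥ x = x 0 := by simp [eFirst, dotProduct]
  simp [Lmat, add_mulVec, mulVec_diagonal, vecMulVec_mulVec, h, mul_comm]

theorem spec_Lmat_diagonal_le {d : ℕ} [NeZero d] {a u : Fin d → ℝ} {c k : ℝ} (hc : 0 ≤ c)
    (hk : 0 ≤ k) (ha : ∀ i, |a i| ≤ c) (hu0 : u 0 = 0) (hu : ∀ j, |u j| ≤ k) :
    spec (Lmat (diagonal a) u) ≤ c + √((d : ℝ) - 1) * k := by
  refine ContinuousLinearMap.opNorm_le_bound _ (by positivity) fun x => ?_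
  have hx : LinearMap.toContinuousLinearMap (toEuclideanLin (Lmat (diagonal a) u)) x =
      WithLp.toLp 2 (fun i => a i * x i) + x 0 • WithLp.toLp 2 u := by
    ext i
    exact Lmat_diagonal_mulVec a u x i
  rw [hx]
  refine (norm_add_le _ _).trans ?_
  rw [norm_smul, add_mul, mul_comm ‖x 0‖]
  gcongr
  · exact norm_toLp_mul_le hc ha x
  · exact norm_toLp_le_of_zero hk hu0 hu
  · exact PiLp.norm_apply_le x 0

theorem Lmat_diagonal_mul_inverse {d : ℕ} [NeZero d] {a u : Fin d → ℝ} (ha : ∀ i, a i ≠ 0)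
    (hu0 : u 0 = 0) :
    Lmat (diagonal a) u * Lmat (diagonal fun i => (a i)⁻¹) (fun i => -(u i / (a i * a 0))) = 1 := by
  refine Matrix.ext_of_mulVec_single fun j => ?_
  ext i
  have h0 := ha 0
  have hi := ha i
  rw [← mulVec_mulVec, one_mulVec]
  simp only [Lmat_diagonal_mulVec, hu0]
  field_simp
  ring

theorem smul_Lmat_add_smul_Lmat {d : ℕ} [NeZero d] {D₀ D₁ : Matrix (Fin d) (Fin d) ℝ}
    (hD₀ : D₀.IsDiag) (hD₁ : D₁.IsDiag) (u₀ u₁ : Fin d → ℝ) (s t : ℝ) :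
    s • Lmat D₀ u₀ + t • Lmat D₁ u₁ =
      Lmat (diagonal fun i => s * D₀ i i + t * D₁ i i) (fun i => s * u₀ i + t * u₁ i) := by
  ext i j
  by_cases h : i = j
  · subst h
    simp [Lmat, vecMulVec_apply]
    ring
  · simp [Lmat, vecMulVec_apply, h, hD₀ h, hD₁ h]
    ring

/-- **Spectral bounds for interpolations of triangular spiked matrices**: for
`Lᵢ = Dᵢ + uᵢ e₁ᵀ` with diagonal `c₁ I ⪯ Dᵢ ⪯ c₂ I` and `uᵢ` having zero first
coordinate and `‖uᵢ‖_∞ ≤ c₃`, every `L_t = (1-t) L₀ + t L₁`, `t ∈ [0,1]`, is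
invertible, with `‖L_t‖₂ ≤ c₂ + √(d-1) c₃` and
`‖L_t⁻¹‖₂ ≤ (c₁ + √(d-1) c₃)/c₁²`. -/
theorem stmt19 {d : ℕ} [NeZero d] (c₁ c₂ c₃ : ℝ)
    (hc₁ : 0 < c₁) (hc₂ : 0 < c₂) (hc₃ : 0 < c₃)
    (D₀ D₁ : Matrix (Fin d) (Fin d) ℝ) (hD₀ : D₀.IsDiag) (hD₁ : D₁.IsDiag)
    (hD₀b : ∀ i, c₁ ≤ D₀ i i ∧ D₀ i i ≤ c₂) (hD₁b : ∀ i, c₁ ≤ D₁ i i ∧ D₁ i i ≤ c₂)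
    (u₀ u₁ : Fin d → ℝ) (hu₀0 : u₀ 0 = 0) (hu₁0 : u₁ 0 = 0)
    (hu₀ : ∀ j, |u₀ j| ≤ c₃) (hu₁ : ∀ j, |u₁ j| ≤ c₃)
    (t : ℝ) (ht : t ∈ Set.Icc (0 : ℝ) 1) :
    IsUnit ((1 - t) • Lmat D₀ u₀ + t • Lmat D₁ u₁) ∧
    spec ((1 - t) • Lmat D₀ u₀ + t • Lmat D₁ u₁) ≤
      c₂ + Real.sqrt ((d : ℝ) - 1) * c₃ ∧
    spec ((1 - t) • Lmat D₀ u₀ + t • Lmat D₁ u₁)⁻¹ ≤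
      (c₁ + Real.sqrt ((d : ℝ) - 1) * c₃) / c₁ ^ 2 := by
  obtain ⟨ht0, ht1⟩ := ht
  have hs0 : 0 ≤ 1 - t := sub_nonneg.mpr ht1
  rw [smul_Lmat_add_smul_Lmat hD₀ hD₁]
  set a : Fin d → ℝ := fun i => (1 - t) * D₀ i i + t * D₁ i i with ha
  set u : Fin d → ℝ := fun i => (1 - t) * u₀ i + t * u₁ i with hu
  have ha₁ : ∀ i, c₁ ≤ a i := fun i => by
    nlinarith [mul_le_mul_of_nonneg_left (hD₀b i).1 hs0, mul_le_mul_of_nonneg_left (hD₁b i).1 ht0]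
  have ha₂ : ∀ i, a i ≤ c₂ := fun i => by
    nlinarith [mul_le_mul_of_nonneg_left (hD₀b i).2 hs0, mul_le_mul_of_nonneg_left (hD₁b i).2 ht0]
  have ha_pos : ∀ i, 0 < a i := fun i => hc₁.trans_le (ha₁ i)
  have hu0 : u 0 = 0 := by simp [hu, hu₀0, hu₁0]
  have hu₃ : ∀ j, |u j| ≤ c₃ := fun j => by
    refine (abs_add_le _ _).trans ?_
    rw [abs_mul, abs_mul, abs_of_nonneg hs0, abs_of_nonneg ht0]
    nlinarith [mul_le_mul_of_nonneg_left (hu₀ j) hs0, mul_le_mul_of_nonneg_left (hu₁ j) ht0]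
  have hinv := Lmat_diagonal_mul_inverse (fun i => (ha_pos i).ne') hu0
  refine ⟨IsUnit.of_mul_eq_one _ hinv, spec_Lmat_diagonal_le hc₂.le hc₃.le
    (fun i => (abs_of_pos (ha_pos i)).trans_le (ha₂ i)) hu0 hu₃, ?_⟩
  rw [inv_eq_right_inv hinv]
  have hbound : (c₁ + √((d : ℝ) - 1) * c₃) / c₁ ^ 2 =
      c₁⁻¹ + √((d : ℝ) - 1) * (c₃ / c₁ ^ 2) := by
    field_simp
  rw [hbound]
  refine spec_Lmat_diagonal_le (by positivity) (by positivity) (fun i => ?_) (by simp [hu0])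
    fun j => ?_
  · rw [abs_of_pos (inv_pos.mpr (ha_pos i))]
    exact inv_anti₀ hc₁ (ha₁ i)
  · rw [abs_neg, abs_div, abs_of_pos (mul_pos (ha_pos j) (ha_pos 0)), sq]
    exact div_le_div₀ hc₃.le (hu₃ j) (by positivity)
      (mul_le_mul (ha₁ j) (ha₁ 0) hc₁.le (ha_pos j).le)
end
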